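/- arXiv:2503.00263 — 4 statements merged into one kernel-verified Lean document; each statement's English description precedes it below -/
import Mathlib

section
/- Every bridgeless cubic graph G admits a perfect matching M such that for every 3-edge-cut C of G, |M ∩ C| = 1 (i.e., M is well spread). -/
open SimpleGraph Set

/-- The edge cut `δ(A)`: edges of `G` with exactly one endpoint in `A`. -/
def edgeCut {V : Type*} (G : SimpleGraph V) (A : Set V) : Set (Sym2 V) :=
  {e | e ∈ G.edgeSet ∧ ∃ u v, e = s(u, v) ∧ u ∈ A ∧ v ∉ A}

/-- A graph is cubic if every vertex has exactly three neighbours. -/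
def IsCubic {V : Type*} (G : SimpleGraph V) : Prop :=
  ∀ v : V, (G.neighborSet v).ncard = 3

/-- A graph is bridgeless if it has no bridge. -/
def Bridgeless {V : Type*} (G : SimpleGraph V) : Prop :=
  ∀ e : Sym2 V, ¬ G.IsBridge e

/-- A connected graph is 3-edge-connected if it stays connected after
removing fewer than three edges. -/
def ThreeEdgeConnected {V : Type*} (G : SimpleGraph V) : Prop :=
  G.Connected ∧ ∀ S : Set (Sym2 V), S.ncard < 3 → (G.deleteEdges S).Connected

/-- A perfect matching viewed as a set of edges: pairwise disjoint edges of `G`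
covering every vertex exactly once. -/
def IsPerfectMatchingSet {V : Type*} (G : SimpleGraph V) (M : Set (Sym2 V)) : Prop :=
  M ⊆ G.edgeSet ∧ ∀ v : V, ∃! e, e ∈ M ∧ v ∈ e

/-! ### Cuts in multigraphs

A multigraph on `W` with edge set `E` is given by two maps `s t : E → W` sending an edge to its
two ends. Loops are allowed and never belong to a cut. -/

section Multigraph

variable {E W : Type*}

open scoped Classical in
/-- The edges of `M` with exactly one end in `B`. -/
noncomputable def cutIn (s t : E → W) (M : Finset E) (B : Set W) : Finset E :=
  M.filter fun e => ¬(s e ∈ B ↔ t e ∈ B)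

variable {s t : E → W} {M N : Finset E} {A B : Set W}

lemma mem_cutIn {e : E} : e ∈ cutIn s t M B ↔ e ∈ M ∧ ¬(s e ∈ B ↔ t e ∈ B) := by
  simp [cutIn]

lemma cutIn_compl : cutIn s t M Bᶜ = cutIn s t M B := by
  ext e; simp [mem_cutIn, not_iff_not]

lemma cutIn_empty : cutIn s t M ∅ = ∅ := by
  ext e; simp [mem_cutIn]

lemma cutIn_univ : cutIn s t M Set.univ = ∅ := by
  ext e; simp [mem_cutIn]

lemma cutIn_comp {X : Type*} (f : W → X) (B : Set X) :
    cutIn (f ∘ s) (f ∘ t) M B = cutIn s t M (f ⁻¹' B) := by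
  ext e; simp [mem_cutIn]

open scoped Classical in
/-- The edges of `M` joining `A \ B` to `B \ A`. -/
noncomputable def crossIn (s t : E → W) (M : Finset E) (A B : Set W) : Finset E :=
  M.filter fun e => (s e ∈ A \ B ∧ t e ∈ B \ A) ∨ (t e ∈ A \ B ∧ s e ∈ B \ A)

lemma crossIn_mono (h : M ⊆ N) : crossIn s t M A B ⊆ crossIn s t N A B := by
  classical exact Finset.filter_subset_filter _ h

lemma card_cutIn_add_card_cutIn (s t : E → W) (M : Finset E) (A B : Set W) :
    (cutIn s t M A).card + (cutIn s t M B).card =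
      (cutIn s t M (A ∩ B)).card + (cutIn s t M (A ∪ B)).card +
        2 * (crossIn s t M A B).card := by
  classical
  simp only [cutIn, crossIn, Finset.card_filter, Finset.mul_sum, ← Finset.sum_add_distrib]
  refine Finset.sum_congr rfl fun e _ => ?_
  by_cases h1 : s e ∈ A <;> by_cases h2 : s e ∈ B <;> by_cases h3 : t e ∈ A <;>
    by_cases h4 : t e ∈ B <;> simp [h1, h2, h3, h4]

lemma even_card_cutIn_add_ncard [Finite W] (h : ∀ v, Odd (cutIn s t M {v}).card) (B : Set W) :
    Even ((cutIn s t M B).card + B.ncard) := by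
  induction B, B.toFinite using Set.Finite.induction_on with
  | empty => simp [cutIn_empty]
  | @insert v B hv hB ih =>
    have h1 := card_cutIn_add_card_cutIn s t M {v} B
    rw [Set.singleton_inter_eq_empty.mpr hv, cutIn_empty, Finset.card_empty,
      Set.singleton_union] at h1
    rw [Set.ncard_insert_of_notMem hv hB]
    have h2 := h v
    grind

lemma even_card_of_odd_card_cutIn [Fintype W] (h : ∀ v, Odd (cutIn s t M {v}).card) :
    Even (Fintype.card W) := by
  simpa [cutIn_univ] using even_card_cutIn_add_ncard h Set.univ

lemma card_cutIn_le [Finite W] {k : ℕ} (h : ∀ v, (cutIn s t M {v}).card ≤ k) (B : Set W) :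
    (cutIn s t M B).card ≤ k * B.ncard := by
  induction B, B.toFinite using Set.Finite.induction_on with
  | empty => simp [cutIn_empty]
  | @insert v B hv hB ih =>
    have h1 := card_cutIn_add_card_cutIn s t M {v} B
    rw [Set.singleton_inter_eq_empty.mpr hv, cutIn_empty, Finset.card_empty,
      Set.singleton_union] at h1
    rw [Set.ncard_insert_of_notMem hv hB]
    have h2 := h v
    grind

/-- If `δ(A)` and `δ(B)` are 3-cuts, `δ(A ∩ B)` is odd, and `M` meets once `δ(A)` and those of
`δ(A ∩ B)` and `δ(A ∪ B)` which are 3-cuts, then it also meets `δ(B)` once. -/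
lemma card_cutIn_eq_one_of_inter_of_union [Fintype E]
    (hb : ∀ C : Set W, (cutIn s t Finset.univ C).card ≠ 1)
    (hA : (cutIn s t Finset.univ A).card = 3) (hB : (cutIn s t Finset.univ B).card = 3)
    (hodd : Odd (cutIn s t Finset.univ (A ∩ B)).card)
    (hMA : (cutIn s t M A).card = 1)
    (hi : (cutIn s t Finset.univ (A ∩ B)).card = 3 → (cutIn s t M (A ∩ B)).card = 1)
    (hu : (cutIn s t Finset.univ (A ∪ B)).card = 3 → (cutIn s t M (A ∪ B)).card = 1) :
    (cutIn s t M B).card = 1 := by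
  have h1 := card_cutIn_add_card_cutIn s t Finset.univ A B
  have h2 := card_cutIn_add_card_cutIn s t M A B
  have h3 := Finset.card_le_card (crossIn_mono (s := s) (t := t) (A := A) (B := B)
    (Finset.subset_univ M))
  have h4 := hb (A ∩ B)
  have h5 := hb (A ∪ B)
  obtain ⟨k, hk⟩ := hodd
  have h6 : (cutIn s t Finset.univ (A ∩ B)).card = 3 := by omega
  have h7 : (cutIn s t Finset.univ (A ∪ B)).card = 3 := by omega
  have := hi h6
  have := hu h7
  omega

/-- If `δ(A)` is a 3-cut and `M` meets once every 3-cut `δ(B)` with `B ⊆ A` or `A ⊆ B`, then it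
meets once every 3-cut. -/
lemma card_cutIn_eq_one_of_laminar [Fintype E]
    (hb : ∀ C : Set W, (cutIn s t Finset.univ C).card ≠ 1)
    (hA : (cutIn s t Finset.univ A).card = 3)
    (hM : ∀ B, (B ⊆ A ∨ A ⊆ B) → (cutIn s t Finset.univ B).card = 3 → (cutIn s t M B).card = 1)
    (hB : (cutIn s t Finset.univ B).card = 3) :
    (cutIn s t M B).card = 1 := by
  have hMA := hM A (.inl subset_rfl) hA
  have key : ∀ B, (cutIn s t Finset.univ B).card = 3 →
      Odd (cutIn s t Finset.univ (A ∩ B)).card → (cutIn s t M B).card = 1 := fun B hB ho =>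
    card_cutIn_eq_one_of_inter_of_union hb hA hB ho hMA
      (hM _ (.inl Set.inter_subset_left)) (hM _ (.inr Set.subset_union_left))
  by_cases ho : Odd (cutIn s t Finset.univ (A ∩ B)).card
  · exact key B hB ho
  · rw [← cutIn_compl]
    refine key Bᶜ (by rwa [cutIn_compl]) ?_
    have h := card_cutIn_add_card_cutIn s t Finset.univ (A ∩ B) (A ∩ Bᶜ)
    rw [Set.inter_union_compl, show A ∩ B ∩ (A ∩ Bᶜ) = ∅ by ext; simp; tauto, cutIn_empty,
      hA, Finset.card_empty] at h
    grind

end Multigraph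

/-- A consequence of Tutte's theorem: if a graph of even order has no perfect matching, then there
are a vertex set `S` and at least `|S| + 2` disjoint odd vertex sets avoiding `S`, all of whose
outside neighbours are in `S`. -/
lemma exists_odd_sets_of_no_perfectMatching {W : Type*} [Fintype W] (G : SimpleGraph W)
    (heven : Even (Fintype.card W)) (h : ¬ ∃ M : G.Subgraph, M.IsPerfectMatching) :
    ∃ (S : Set W) (P : Finset (Set W)), S.ncard + 2 ≤ P.card ∧
      (P : Set (Set W)).PairwiseDisjoint id ∧
      ∀ C ∈ P, Odd C.ncard ∧ Disjoint C S ∧ ∀ u ∈ C, ∀ v, G.Adj u v → v ∈ C ∨ v ∈ S := by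
  classical
  rw [SimpleGraph.tutte] at h
  push Not at h
  obtain ⟨S, hS⟩ := h
  rw [SimpleGraph.IsTutteViolator] at hS
  set H := ((⊤ : G.Subgraph).deleteVerts S).coe with hH
  have hpar := SimpleGraph.odd_ncard_oddComponents H
  have hcard : Nat.card ((⊤ : G.Subgraph).deleteVerts S).verts + S.ncard = Fintype.card W := by
    have := Set.ncard_add_ncard_compl S
    rw [Nat.card_coe_set_eq, ← Nat.card_eq_fintype_card, ← this]
    simp [Set.compl_eq_univ_sdiff, add_comm]
  have hinj : Function.Injective
      fun C : H.ConnectedComponent => (Subtype.val '' C.supp : Set W) := fun C D hCD =>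
    SimpleGraph.ConnectedComponent.supp_injective
      (Set.image_injective.mpr Subtype.val_injective hCD)
  refine ⟨S, (H.oddComponents.toFinset).image
    fun C => (Subtype.val '' C.supp : Set W), ?_, ?_, ?_⟩
  · rw [Finset.card_image_of_injective _ hinj, ← Set.ncard_eq_toFinset_card']
    grind
  · intro X hX Y hY hXY
    simp only [Finset.coe_image, Set.coe_toFinset, Set.mem_image] at hX hY
    obtain ⟨C, -, rfl⟩ := hX
    obtain ⟨D, -, rfl⟩ := hY
    have hCD : C ≠ D := fun h => hXY (by rw [h])
    exact (Set.disjoint_image_iff Subtype.val_injective).mpr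
      (SimpleGraph.pairwise_disjoint_supp_connectedComponent H hCD)
  · intro X hX
    simp only [Finset.mem_image, Set.mem_toFinset] at hX
    obtain ⟨C, hC, rfl⟩ := hX
    refine ⟨?_, ?_, ?_⟩
    · rw [Set.ncard_image_of_injective _ Subtype.val_injective]
      exact hC
    · rw [Set.disjoint_left]
      rintro _ ⟨u, -, rfl⟩
      exact u.2.2
    · rintro _ ⟨u, hu, rfl⟩ v huv
      by_cases hv : v ∈ S
      · exact .inr hv
      · refine .inl ⟨⟨v, by simp [hv]⟩, ?_, rfl⟩
        refine C.mem_supp_of_adj_mem_supp hu ?_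
        have := u.2
        simp only [hH, SimpleGraph.Subgraph.coe_adj, SimpleGraph.Subgraph.deleteVerts_adj]
        simp_all

section Cubic

variable {E W : Type*}

/-- The simple graph underlying the multigraph formed by the edges in `A`. -/
def underlyingGraph (s t : E → W) (A : Set E) : SimpleGraph W where
  Adj u v := u ≠ v ∧ ∃ h ∈ A, s(s h, t h) = s(u, v)
  symm := ⟨fun _ _ ⟨hne, h, hA, hh⟩ => ⟨hne.symm, h, hA, hh.trans Sym2.eq_swap⟩⟩
  loopless := ⟨fun _ h => h.1 rfl⟩

lemma exists_finset_of_isPerfectMatching [Fintype E] {s t : E → W} {A : Set E}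
    {K : (underlyingGraph s t A).Subgraph} (hK : K.IsPerfectMatching) :
    ∃ M : Finset E, (∀ e ∈ M, e ∈ A) ∧ ∀ v, (cutIn s t M {v}).card = 1 := by
  classical
  have hex : ∀ p : Sym2 W, p ∈ K.edgeSet → ∃ h ∈ A, s(s h, t h) = p := by
    intro p
    induction p with
    | h u v => exact fun hp => (K.adj_sub hp).2
  rcases isEmpty_or_nonempty W with hW | ⟨⟨v₀⟩⟩
  · exact ⟨∅, by simp, fun v => hW.elim v⟩
  obtain ⟨w₀, hw₀, -⟩ := hK.1 (hK.2 v₀)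
  have : Nonempty E := ⟨(hex s(v₀, w₀) hw₀).choose⟩
  choose! ch hchA hch using hex
  refine ⟨Finset.univ.filter fun h => s(s h, t h) ∈ K.edgeSet ∧ ch s(s h, t h) = h, ?_, ?_⟩
  · intro e he
    simp only [Finset.mem_filter, Finset.mem_univ, true_and] at he
    rw [← he.2]
    exact hchA _ he.1
  · intro v
    obtain ⟨w, hw, huniq⟩ := hK.1 (hK.2 v)
    have hw' : s(v, w) ∈ K.edgeSet := hw
    have hne := hw.ne
    rw [Finset.card_eq_one]
    refine ⟨ch s(v, w), ?_⟩
    ext h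
    simp only [mem_cutIn, Finset.mem_filter, Finset.mem_univ, true_and, Set.mem_singleton_iff,
      Finset.mem_singleton]
    constructor
    · rintro ⟨⟨h1, h2⟩, h3⟩
      have : s(s h, t h) = s(v, w) := by
        by_cases hs : s h = v
        · rw [hs] at h1 ⊢
          rw [huniq _ (K.mem_edgeSet.mp h1)]
        · have ht : t h = v := by tauto
          rw [ht, Sym2.eq_swap] at h1 ⊢
          rw [huniq _ (K.mem_edgeSet.mp h1)]
      rw [← this, h2]
    · rintro rfl
      refine ⟨by rw [hch _ hw']; exact ⟨hw', rfl⟩, ?_⟩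
      have := hch _ hw'
      rw [Sym2.eq_iff] at this
      grind

lemma card_filter_mem_le_one {P : Finset (Set W)} (hP : (P : Set (Set W)).PairwiseDisjoint id)
    (v : W) [DecidablePred fun C : Set W => v ∈ C] : (P.filter fun C => v ∈ C).card ≤ 1 := by
  rw [Finset.card_le_one]
  intro C hC D hD
  simp only [Finset.mem_filter] at hC hD
  by_contra hne
  exact Set.disjoint_left.mp (hP hC.1 hD.1 hne) hC.2 hD.2

/-- Each edge which is not a loop in a bridgeless cubic multigraph is in a perfect matching. -/
lemma exists_perfectMatching_of_cubic [Fintype E] [Fintype W] {s t : E → W}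
    (hc : ∀ v, (cutIn s t Finset.univ {v}).card = 3)
    (hb : ∀ B, (cutIn s t Finset.univ B).card ≠ 1) {e : E} (he : s e ≠ t e) :
    ∃ M : Finset E, e ∈ M ∧ ∀ v, (cutIn s t M {v}).card = 1 := by
  classical
  have hodd : ∀ v, Odd (cutIn s t Finset.univ {v}).card := fun v => by rw [hc v]; decide
  set A : Set E := {h | h = e ∨ (s h ≠ s e ∧ t h ≠ s e)} with hA
  by_cases h : ∃ K : (underlyingGraph s t A).Subgraph, K.IsPerfectMatching
  · obtain ⟨K, hK⟩ := h
    obtain ⟨M, hMA, hM⟩ := exists_finset_of_isPerfectMatching hK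
    refine ⟨M, ?_, hM⟩
    obtain ⟨h, hh⟩ := Finset.card_eq_one.mp (hM (s e))
    have hmem : h ∈ cutIn s t M {s e} := by simp [hh]
    rw [mem_cutIn] at hmem
    have := hMA h hmem.1
    simp only [hA, Set.mem_ofPred_eq, Set.mem_singleton_iff] at this hmem
    rcases this with rfl | this
    · exact hmem.1
    · tauto
  · exfalso
    obtain ⟨S, P, hcard, hdisj, hP⟩ :=
      exists_odd_sets_of_no_perfectMatching _ (even_card_of_odd_card_cutIn hodd) h
    have hlow : ∀ C ∈ P, 3 ≤ (cutIn s t Finset.univ C).card := by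
      intro C hC
      have h1 := even_card_cutIn_add_ncard hodd C
      have h2 := (hP C hC).1
      have h3 := hb C
      grind
    have hsum : ∑ C ∈ P, (cutIn s t Finset.univ C).card =
        ∑ h, (P.filter fun C => ¬(s h ∈ C ↔ t h ∈ C)).card := by
      simp only [cutIn]
      exact Finset.sum_card_bipartiteAbove_eq_sum_card_bipartiteBelow _
    have hedge : ∀ h, (P.filter fun C => ¬(s h ∈ C ↔ t h ∈ C)).card ≤
        (if h ∈ cutIn s t Finset.univ S then 1 else 0) +
          2 * (if h ∈ (cutIn s t Finset.univ {s e}).erase e then 1 else 0) := by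
      intro h
      have hs := card_filter_mem_le_one hdisj (s h)
      have ht := card_filter_mem_le_one hdisj (t h)
      have hle : (P.filter fun C => ¬(s h ∈ C ↔ t h ∈ C)).card ≤
          (P.filter fun C => s h ∈ C).card + (P.filter fun C => t h ∈ C).card := by
        refine le_trans (Finset.card_le_card ?_) (Finset.card_union_le _ _)
        intro C
        simp only [Finset.mem_filter, Finset.mem_union]
        tauto
      have hsS : s h ∈ S → (P.filter fun C => s h ∈ C).card = 0 := by
        intro hS
        rw [Finset.card_eq_zero, Finset.filter_eq_empty_iff]
        exact fun C hC hsC => Set.disjoint_left.mp (hP C hC).2.1 hsC hS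
      have htS : t h ∈ S → (P.filter fun C => t h ∈ C).card = 0 := by
        intro hS
        rw [Finset.card_eq_zero, Finset.filter_eq_empty_iff]
        exact fun C hC hsC => Set.disjoint_left.mp (hP C hC).2.1 hsC hS
      simp only [mem_cutIn, Finset.mem_erase, Finset.mem_univ, true_and, Set.mem_singleton_iff]
      by_cases hh : h ≠ e ∧ ¬(s h = s e ↔ t h = s e)
      · rw [if_pos hh]
        omega
      by_cases hhS : s h ∈ S ↔ t h ∈ S
      · by_cases hS : s h ∈ S
        · have := hsS hS
          have := htS (hhS.mp hS)
          omega
        have hS' : t h ∉ S := fun h' => hS (hhS.mpr h')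
        have : (P.filter fun C => ¬(s h ∈ C ↔ t h ∈ C)).card = 0 := by
          rw [Finset.card_eq_zero, Finset.filter_eq_empty_iff]
          intro C hC
          rw [not_not]
          by_cases hst : s h = t h
          · rw [hst]
          have hhA : h ∈ A := by
            simp only [hA, Set.mem_ofPred_eq]
            grind
          have hadj : (underlyingGraph s t A).Adj (s h) (t h) := ⟨hst, h, hhA, rfl⟩
          have h1 := (hP C hC).2.2
          exact ⟨fun h' => (h1 _ h' _ hadj).resolve_right hS',
            fun h' => (h1 _ h' _ hadj.symm).resolve_right hS⟩
        omega
      · rw [if_pos hhS]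
        by_cases hS : s h ∈ S
        · have := hsS hS
          omega
        · have := htS (by tauto)
          omega
    have hupp : ∑ C ∈ P, (cutIn s t Finset.univ C).card ≤
        (cutIn s t Finset.univ S).card + 2 * 2 := by
      rw [hsum]
      refine (Finset.sum_le_sum fun h _ => hedge h).trans ?_
      rw [Finset.sum_add_distrib, ← Finset.mul_sum]
      simp only [Finset.sum_boole, Finset.filter_univ_mem, Nat.cast_id]
      rw [Finset.card_erase_of_mem (by simp [mem_cutIn, he.symm]), hc]
    have hS := card_cutIn_le (k := 3) (fun v => (hc v).le) S
    have := Finset.card_nsmul_le_sum P _ 3 hlow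
    simp only [smul_eq_mul] at this
    omega

/-- The map contracting the set `A` to a single vertex `none`. -/
noncomputable def contract {W : Type*} (A : Set W) (v : W) : Option {v // v ∉ A} :=
  open scoped Classical in if h : v ∈ A then none else some ⟨v, h⟩

lemma contract_eq_none {W : Type*} {A : Set W} {v : W} : contract A v = none ↔ v ∈ A := by
  simp [contract]

lemma contract_eq_some {W : Type*} {A : Set W} {v : W} {w : {v // v ∉ A}} :
    contract A v = some w ↔ v = w := by
  unfold contract
  split_ifs with h
  · simp only [false_iff]
    rintro rfl
    exact w.2 h
  · simp [Subtype.ext_iff]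

lemma eq_of_contract_eq {W : Type*} {A : Set W} {v w : W} (h : contract A v = contract A w) :
    v = w ∨ (v ∈ A ∧ w ∈ A) := by
  by_cases hv : v ∈ A
  · exact .inr ⟨hv, contract_eq_none.mp (h.symm.trans (contract_eq_none.mpr hv))⟩
  · left
    exact (contract_eq_some (w := ⟨v, hv⟩).mp (h.symm.trans (contract_eq_some.mpr rfl))).symm

lemma exists_preimage_contract {W : Type*} {A B : Set W} (h : Disjoint A B ∨ A ⊆ B) :
    ∃ C, contract A ⁻¹' C = B := by
  refine ⟨contract A '' B, Set.Subset.antisymm ?_ (Set.subset_preimage_image _ _)⟩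
  rintro v ⟨w, hw, hwv⟩
  rcases eq_of_contract_eq hwv with rfl | ⟨hwA, hvA⟩
  · exact hw
  · rcases h with h | h
    · exact (Set.disjoint_left.mp h hwA hw).elim
    · exact h hvA

lemma card_contract_lt {W : Type*} [Finite W] {A : Set W} (hA : 1 < A.ncard) :
    Nat.card (Option {v // v ∉ A}) < Nat.card W := by
  have h := Set.ncard_add_ncard_compl A
  rw [Finite.card_option]
  have : Nat.card {v // v ∉ A} = Aᶜ.ncard := rfl
  omega

/-- In a bridgeless cubic multigraph, every edge which is not a loop is in a set of edges meeting
each 3-cut exactly once. -/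
theorem exists_wellSpread_of_cubic {E : Type*} [Fintype E] (n : ℕ) {W : Type*} [Finite W]
    (hn : Nat.card W = n) {s t : E → W}
    (hc : ∀ v, (cutIn s t Finset.univ {v}).card = 3)
    (hb : ∀ B, (cutIn s t Finset.univ B).card ≠ 1) {e : E} (he : s e ≠ t e) :
    ∃ M : Finset E, e ∈ M ∧
      ∀ B, (cutIn s t Finset.univ B).card = 3 → (cutIn s t M B).card = 1 := by
  classical
  induction n using Nat.strong_induction_on generalizing W e with
  | _ n ih =>
  by_cases hA : ∃ A : Set W, (cutIn s t Finset.univ A).card = 3 ∧ 1 < A.ncard ∧ 1 < Aᶜ.ncard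
  · have hcontract : ∀ A : Set W, (cutIn s t Finset.univ A).card = 3 → 1 < A.ncard →
        ∀ e, s e ≠ t e → ¬(s e ∈ A ∧ t e ∈ A) → ∃ M : Finset E, e ∈ M ∧
          ∀ B, (Disjoint A B ∨ A ⊆ B) →
            (cutIn s t Finset.univ B).card = 3 → (cutIn s t M B).card = 1 := by
      intro A hA3 hA1 e he heA
      obtain ⟨M, heM, hM⟩ := ih _ (hn ▸ card_contract_lt hA1) rfl (s := contract A ∘ s)
        (t := contract A ∘ t) (e := e) (by
          rintro (_ | v)
          · rw [cutIn_comp, ← hA3]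
            congr 2
            ext v
            exact contract_eq_none
          · rw [cutIn_comp, ← hc v.1]
            congr 2
            ext w
            exact contract_eq_some)
        (fun B => by rw [cutIn_comp]; exact hb _)
        (fun h => (eq_of_contract_eq h).elim he heA)
      refine ⟨M, heM, fun B hB hB3 => ?_⟩
      obtain ⟨C, rfl⟩ := exists_preimage_contract hB
      rw [← cutIn_comp] at hB3 ⊢
      exact hM C hB3
    obtain ⟨A, hA3, hA1, hA1', heA⟩ : ∃ A : Set W, (cutIn s t Finset.univ A).card = 3 ∧
        1 < A.ncard ∧ 1 < Aᶜ.ncard ∧ ¬(s e ∈ A ∧ t e ∈ A) := by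
      obtain ⟨A, hA3, hA1, hA1'⟩ := hA
      by_cases heA : s e ∈ A ∧ t e ∈ A
      · exact ⟨Aᶜ, by rwa [cutIn_compl], hA1', by rwa [compl_compl], by simp [heA.1]⟩
      · exact ⟨A, hA3, hA1, hA1', heA⟩
    obtain ⟨M₁, heM₁, hM₁⟩ := hcontract A hA3 hA1 e he heA
    obtain ⟨c, hc₁⟩ := Finset.card_eq_one.mp (hM₁ A (.inr subset_rfl) hA3)
    have hcA : c ∈ cutIn s t M₁ A := by simp [hc₁]
    rw [mem_cutIn] at hcA
    obtain ⟨M₂, hcM₂, hM₂⟩ := hcontract Aᶜ (by rwa [cutIn_compl]) hA1' c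
      (fun h => hcA.2 (by rw [h])) (by simp only [Set.mem_compl_iff]; tauto)
    obtain ⟨c', hc₂⟩ := Finset.card_eq_one.mp (hM₂ A (.inl disjoint_compl_left) hA3)
    obtain rfl : c = c' := by
      have : c ∈ cutIn s t M₂ A := mem_cutIn.mpr ⟨hcM₂, hcA.2⟩
      simpa [hc₂] using this
    have hagree : ∀ h, ¬(s h ∈ A ↔ t h ∈ A) → (h ∈ M₁ ↔ h ∈ M₂) := by
      intro h hh
      have h1 : h ∈ cutIn s t M₁ A ↔ h ∈ cutIn s t M₂ A := by rw [hc₁, hc₂]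
      simpa [mem_cutIn, hh] using h1
    set M : Finset E := Finset.univ.filter fun h =>
      if s h ∈ A ∧ t h ∈ A then h ∈ M₂ else h ∈ M₁ with hM
    have hMM₁ : ∀ B, (A ⊆ B ∨ Disjoint A B) → cutIn s t M B = cutIn s t M₁ B := by
      intro B hB
      ext h
      have h1 : (s h ∈ A ∧ t h ∈ A) → (s h ∈ B ↔ t h ∈ B) := by
        rintro ⟨h1, h2⟩
        rcases hB with hB | hB
        · exact iff_of_true (hB h1) (hB h2)
        · exact iff_of_false (Set.disjoint_left.mp hB h1) (Set.disjoint_left.mp hB h2)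
      simp only [mem_cutIn, hM, Finset.mem_filter, Finset.mem_univ, true_and]
      split_ifs with h2
      · simp [h1 h2]
      · rfl
    have hMM₂ : ∀ B, B ⊆ A → cutIn s t M B = cutIn s t M₂ B := by
      intro B hB
      ext h
      have h1 := hagree h
      have h2 := @hB (s h)
      have h3 := @hB (t h)
      simp only [mem_cutIn, hM, Finset.mem_filter, Finset.mem_univ, true_and]
      split_ifs with h4
      · rfl
      · tauto
    refine ⟨M, by simp [hM, heA, heM₁], fun B hB => ?_⟩
    refine card_cutIn_eq_one_of_laminar hb hA3 ?_ hB
    rintro B (hBA | hAB) hB3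
    · rw [hMM₂ B hBA]
      exact hM₂ B (.inl (Set.disjoint_left.mpr fun v hv hvB => hv (hBA hvB))) hB3
    · rw [hMM₁ B (.inl hAB)]
      exact hM₁ B (.inr hAB) hB3
  · push Not at hA
    have : Fintype W := Fintype.ofFinite W
    obtain ⟨M, heM, hM⟩ := exists_perfectMatching_of_cubic hc hb he
    refine ⟨M, heM, ?_⟩
    have hsmall : ∀ B : Set W, (cutIn s t Finset.univ B).card = 3 → B.ncard ≤ 1 →
        (cutIn s t M B).card = 1 := by
      intro B hB hB1
      rcases (Set.ncard_le_one_iff_subsingleton.mp hB1).eq_empty_or_singleton with rfl | ⟨v, rfl⟩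
      · simp [cutIn_empty] at hB
      · exact hM v
    intro B hB
    by_cases hB1 : B.ncard ≤ 1
    · exact hsmall B hB hB1
    · rw [← cutIn_compl] at hB ⊢
      exact hsmall Bᶜ hB (hA B (by rwa [cutIn_compl] at hB) (by omega))

end Cubic

section SimpleGraphCuts

variable {V : Type*} (G : SimpleGraph V)

/-- An arbitrarily chosen first end of an edge. -/
noncomputable def edgeFst (e : G.edgeSet) : V := (Quot.out e.1).1

/-- The end of an edge other than `edgeFst`. -/
noncomputable def edgeSnd (e : G.edgeSet) : V := (Quot.out e.1).2

variable {G}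

lemma mk_edgeFst_edgeSnd (e : G.edgeSet) : s(edgeFst G e, edgeSnd G e) = e.1 :=
  Quot.out_eq e.1

lemma edgeFst_ne_edgeSnd (e : G.edgeSet) : edgeFst G e ≠ edgeSnd G e := by
  have h := e.2
  rw [← mk_edgeFst_edgeSnd e] at h
  exact G.ne_of_adj h

lemma mem_edgeCut_iff {e : G.edgeSet} {A : Set V} :
    e.1 ∈ edgeCut G A ↔ ¬(edgeFst G e ∈ A ↔ edgeSnd G e ∈ A) := by
  simp only [edgeCut, Set.mem_ofPred_eq, e.2, true_and]
  rw [← mk_edgeFst_edgeSnd e]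
  constructor
  · rintro ⟨u, v, h, hu, hv⟩
    rcases Sym2.eq_iff.mp h with ⟨h1, h2⟩ | ⟨h1, h2⟩ <;> rw [h1, h2] <;> tauto
  · intro h
    by_cases hA : edgeFst G e ∈ A
    · exact ⟨_, _, rfl, hA, by tauto⟩
    · exact ⟨_, _, Sym2.eq_swap, by tauto, hA⟩

lemma mem_iff_mem_edgeCut_singleton {e : G.edgeSet} {v : V} :
    v ∈ e.1 ↔ e.1 ∈ edgeCut G {v} := by
  have := edgeFst_ne_edgeSnd e
  rw [mem_edgeCut_iff, Set.mem_singleton_iff, Set.mem_singleton_iff, ← mk_edgeFst_edgeSnd e,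
    Sym2.mem_iff]
  grind

lemma image_cutIn (M : Finset G.edgeSet) (A : Set V) :
    Subtype.val '' (cutIn (edgeFst G) (edgeSnd G) M A : Set G.edgeSet) =
      Subtype.val '' (M : Set G.edgeSet) ∩ edgeCut G A := by
  ext e
  constructor
  · rintro ⟨e, he, rfl⟩
    rw [Finset.mem_coe, mem_cutIn] at he
    exact ⟨⟨e, he.1, rfl⟩, mem_edgeCut_iff.mpr he.2⟩
  · rintro ⟨⟨e, he, rfl⟩, heA⟩
    exact ⟨e, mem_cutIn.mpr ⟨he, mem_edgeCut_iff.mp heA⟩, rfl⟩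

lemma ncard_image_inter_edgeCut (M : Finset G.edgeSet) (A : Set V) :
    (Subtype.val '' (M : Set G.edgeSet) ∩ edgeCut G A).ncard =
      (cutIn (edgeFst G) (edgeSnd G) M A).card := by
  rw [← image_cutIn, Set.ncard_image_of_injective _ Subtype.val_injective, Set.ncard_coe_finset]

lemma ncard_edgeCut [Fintype G.edgeSet] (A : Set V) :
    (edgeCut G A).ncard = (cutIn (edgeFst G) (edgeSnd G) Finset.univ A).card := by
  rw [← ncard_image_inter_edgeCut]
  congr 1
  ext e
  simp only [Finset.coe_univ, Set.image_univ, Subtype.range_coe_subtype]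
  exact ⟨fun h => ⟨h.1, h⟩, fun h => h.2⟩

lemma IsCubic.ncard_edgeCut_singleton (h : IsCubic G) (v : V) : (edgeCut G {v}).ncard = 3 := by
  rw [← h v, ← Set.ncard_image_of_injective (f := fun w => s(v, w)) (G.neighborSet v)
    fun w w' hw => Sym2.congr_right.mp hw]
  congr 1
  ext e
  constructor
  · rintro ⟨he, u, w, rfl, rfl, -⟩
    exact ⟨w, he, rfl⟩
  · rintro ⟨w, hw, rfl⟩
    exact ⟨hw, v, w, rfl, rfl, fun h => G.ne_of_adj hw h.symm⟩

lemma Bridgeless.ncard_edgeCut_ne_one (h : Bridgeless G) (A : Set V) :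
    (edgeCut G A).ncard ≠ 1 := by
  intro hA
  obtain ⟨e, he⟩ := Set.ncard_eq_one.mp hA
  have heA : e ∈ edgeCut G A := by simp [he]
  obtain ⟨-, u, v, rfl, hu, hv⟩ := heA
  refine h s(u, v) (SimpleGraph.isBridge_iff.mpr ?_)
  rintro ⟨p⟩
  obtain ⟨d, -, hd₁, hd₂⟩ := p.exists_boundary_dart A hu hv
  have hd := d.adj
  rw [SimpleGraph.deleteEdges_adj] at hd
  exact hd.2 (he.subset ⟨hd.1, _, _, rfl, hd₁, hd₂⟩)

end SimpleGraphCuts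

theorem stmt_1 {V : Type*} [Fintype V] (G : SimpleGraph V)
    (hcubic : IsCubic G) (hbridgeless : Bridgeless G) :
    ∃ M : Set (Sym2 V), IsPerfectMatchingSet G M ∧
      ∀ A : Set V, A.Nonempty → A ≠ Set.univ → (edgeCut G A).ncard = 3 →
        (M ∩ edgeCut G A).ncard = 1 := by
  classical
  rcases isEmpty_or_nonempty V with hV | ⟨⟨v⟩⟩
  · exact ⟨∅, ⟨Set.empty_subset _, fun v => hV.elim v⟩, fun A ⟨v, _⟩ => hV.elim v⟩
  have hv : (edgeCut G {v}).Nonempty := by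
    rw [← Set.ncard_pos, hcubic.ncard_edgeCut_singleton]
    decide
  obtain ⟨e, he⟩ := hv
  obtain ⟨M, -, hM⟩ := exists_wellSpread_of_cubic _ rfl (s := edgeFst G) (t := edgeSnd G)
    (fun v => by rw [← ncard_edgeCut, hcubic.ncard_edgeCut_singleton])
    (fun B => by rw [← ncard_edgeCut]; exact hbridgeless.ncard_edgeCut_ne_one B)
    (edgeFst_ne_edgeSnd ⟨e, he.1⟩)
  simp_rw [← ncard_edgeCut, ← ncard_image_inter_edgeCut] at hM
  refine ⟨Subtype.val '' (M : Set G.edgeSet), ⟨by rintro _ ⟨e, -, rfl⟩; exact e.2, fun v => ?_⟩,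
    fun A _ _ => hM A⟩
  obtain ⟨e, he⟩ := Set.ncard_eq_one.mp (hM {v} (hcubic.ncard_edgeCut_singleton v))
  have hiff : ∀ f, (f ∈ Subtype.val '' (M : Set G.edgeSet) ∧ v ∈ f) ↔ f = e := by
    intro f
    rw [← Set.mem_singleton_iff, ← he, Set.mem_inter_iff]
    refine and_congr_right ?_
    rintro ⟨f, -, rfl⟩
    exact mem_iff_mem_edgeCut_singleton
  exact ⟨e, (hiff e).mpr rfl, fun f hf => (hiff f).mp hf⟩
end

section
/- Let G be a 3-edge-connected cubic graph and let A, B be vertex subsets with ∅ ≠ A ⊊ V(G), ∅ ≠ B ⊊ V(G), |δ(A)| = 3 and |δ(B)| = 3. Then A and B do not cross: A ∩ B = ∅, or A ⊆ B, or B ⊆ A, or A ∪ B = V(G). -/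
open SimpleGraph Set

/-- The edges of `G` with one endpoint in `X` and the other in `Y`. -/
def edgesBetween {V : Type*} (G : SimpleGraph V) (X Y : Set V) : Set (Sym2 V) :=
  {e | e ∈ G.edgeSet ∧ ∃ u v, e = s(u, v) ∧ u ∈ X ∧ v ∈ Y}

theorem edgesBetween_comm {V : Type*} (G : SimpleGraph V) (X Y : Set V) :
    edgesBetween G X Y = edgesBetween G Y X := by
  ext e
  constructor <;>
  · rintro ⟨he, u, v, rfl, hu, hv⟩
    exact ⟨he, v, u, Sym2.eq_swap, hv, hu⟩

theorem edgeCut_eq_edgesBetween {V : Type*} (G : SimpleGraph V) (X : Set V) :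
    edgeCut G X = edgesBetween G X Xᶜ := rfl

theorem ncard_edgesBetween_union_right {V : Type*} [Finite V] (G : SimpleGraph V)
    {X Y Z : Set V} (hXZ : Disjoint X Z) (hYZ : Disjoint Y Z) :
    (edgesBetween G X (Y ∪ Z)).ncard =
      (edgesBetween G X Y).ncard + (edgesBetween G X Z).ncard := by
  rw [← Set.ncard_union_eq _ (Set.toFinite _) (Set.toFinite _)]
  · congr 1
    ext e
    constructor
    · rintro ⟨he, u, v, h, hu, hv | hv⟩
      exacts [Or.inl ⟨he, u, v, h, hu, hv⟩, Or.inr ⟨he, u, v, h, hu, hv⟩]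
    · rintro (⟨he, u, v, h, hu, hv⟩ | ⟨he, u, v, h, hu, hv⟩)
      exacts [⟨he, u, v, h, hu, Or.inl hv⟩, ⟨he, u, v, h, hu, Or.inr hv⟩]
  · rw [Set.disjoint_left]
    rintro e ⟨-, u, v, rfl, hu, hv⟩ ⟨-, u', v', h, hu', hv'⟩
    rcases Sym2.eq_iff.1 h with ⟨rfl, rfl⟩ | ⟨rfl, rfl⟩
    exacts [Set.disjoint_left.1 hYZ hv hv', Set.disjoint_left.1 hXZ hu hv']

theorem ncard_edgesBetween_union_left {V : Type*} [Finite V] (G : SimpleGraph V)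
    {X Y Z : Set V} (hXZ : Disjoint X Z) (hYZ : Disjoint Y Z) :
    (edgesBetween G (Y ∪ Z) X).ncard =
      (edgesBetween G Y X).ncard + (edgesBetween G Z X).ncard := by
  simp only [edgesBetween_comm G _ X, ncard_edgesBetween_union_right G hXZ hYZ]

theorem ThreeEdgeConnected.three_le_ncard_edgeCut {V : Type*} {G : SimpleGraph V}
    (h : ThreeEdgeConnected G) {X : Set V} (hX : X.Nonempty) (hX' : Xᶜ.Nonempty) :
    3 ≤ (edgeCut G X).ncard := by
  by_contra! hlt
  obtain ⟨a, ha⟩ := hX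
  obtain ⟨b, hb⟩ := hX'
  obtain ⟨p⟩ := (h.2 _ hlt).preconnected a b
  obtain ⟨d, -, hd, hd'⟩ := p.exists_boundary_dart X ha hb
  have hadj := d.adj
  rw [SimpleGraph.deleteEdges_adj] at hadj
  exact hadj.2 ⟨hadj.1, d.fst, d.snd, rfl, hd, hd'⟩

theorem stmt_4 {V : Type*} [Fintype V] (G : SimpleGraph V)
    (h3ec : ThreeEdgeConnected G) (hcubic : IsCubic G)
    (A B : Set V) (hA : A.Nonempty) (hA' : A ≠ Set.univ)
    (hB : B.Nonempty) (hB' : B ≠ Set.univ)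
    (hAcut : (edgeCut G A).ncard = 3) (hBcut : (edgeCut G B).ncard = 3) :
    A ∩ B = ∅ ∨ A ⊆ B ∨ B ⊆ A ∨ A ∪ B = Set.univ := by
  by_contra! hcon
  obtain ⟨h₁, h₂, h₃, h₄⟩ := hcon
  have n₂ : (A \ B).Nonempty := Set.sdiff_nonempty.2 h₂
  have n₃ : (B \ A).Nonempty := Set.sdiff_nonempty.2 h₃
  have n₄ : ((A ∪ B)ᶜ).Nonempty := Set.nonempty_compl.2 h₄
  have eA : A = A ∩ B ∪ A \ B := (Set.inter_union_sdiff A B).symm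
  have eA' : Aᶜ = B \ A ∪ (A ∪ B)ᶜ := by ext; simp; tauto
  have eB : B = A ∩ B ∪ B \ A := by ext; simp; tauto
  have eB' : Bᶜ = A \ B ∪ (A ∪ B)ᶜ := by ext; simp; tauto
  have e₁ : (A ∩ B)ᶜ = A \ B ∪ (B \ A ∪ (A ∪ B)ᶜ) := by ext; simp; tauto
  have e₂ : (A \ B)ᶜ = A ∩ B ∪ (B \ A ∪ (A ∪ B)ᶜ) := by ext; simp; tauto
  have e₃ : (B \ A)ᶜ = A ∩ B ∪ (A \ B ∪ (A ∪ B)ᶜ) := by ext; simp; tauto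
  have e₄ : (A ∪ B)ᶜᶜ = A ∩ B ∪ (A \ B ∪ B \ A) := by ext; simp; tauto
  have c₁ := h3ec.three_le_ncard_edgeCut h₁ (e₁ ▸ n₂.inl)
  have c₂ := h3ec.three_le_ncard_edgeCut n₂ (e₂ ▸ h₁.inl)
  have c₃ := h3ec.three_le_ncard_edgeCut n₃ (e₃ ▸ h₁.inl)
  have c₄ := h3ec.three_le_ncard_edgeCut n₄ (e₄ ▸ h₁.inl)
  have d₁₂ : Disjoint (A ∩ B) (A \ B) := by grind
  have d₁₃ : Disjoint (A ∩ B) (B \ A) := by grind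
  have d₁₄ : Disjoint (A ∩ B) (A ∪ B)ᶜ := by grind
  have d₂₃ : Disjoint (A \ B) (B \ A) := by grind
  have d₂₄ : Disjoint (A \ B) (A ∪ B)ᶜ := by grind
  have d₃₄ : Disjoint (B \ A) (A ∪ B)ᶜ := by grind
  rw [edgeCut_eq_edgesBetween] at hAcut hBcut c₁ c₂ c₃ c₄
  rw [eA'] at hAcut
  rw [eB'] at hBcut
  rw [e₁] at c₁
  rw [e₂] at c₂
  rw [e₃] at c₃
  rw [e₄] at c₄
  generalize A ∩ B = P at *
  generalize A \ B = Q at *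
  generalize B \ A = R at *
  generalize (A ∪ B)ᶜ = S at *
  subst eA eB
  rw [ncard_edgesBetween_union_right G (by simp [*]) (by simp [*]),
    ncard_edgesBetween_union_left G (by simp [*, disjoint_comm]) (by simp [*]),
    ncard_edgesBetween_union_left G (by simp [*, disjoint_comm]) (by simp [*])] at hAcut hBcut
  rw [ncard_edgesBetween_union_right G (by simp [*, disjoint_comm])
      (by simp [*]),
    ncard_edgesBetween_union_right G (by simp [*, disjoint_comm])
      (by simp [*])] at c₁ c₂ c₃ c₄
  have s₂₁ := edgesBetween_comm G Q P
  have s₃₁ := edgesBetween_comm G R P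
  have s₃₂ := edgesBetween_comm G R Q
  have s₄₁ := edgesBetween_comm G S P
  have s₄₂ := edgesBetween_comm G S Q
  have s₄₃ := edgesBetween_comm G S R
  simp only [s₂₁, s₃₁, s₃₂, s₄₁, s₄₂, s₄₃] at *
  omega
end

section
/- Let G be a bridgeless cubic graph on n vertices and let M₁ be a perfect matching of G containing exactly one edge of every 3-edge-cut of G. Then there exists a perfect matching M₂ of G with |M₁ ∩ M₂| ≤ n/10. -/
open SimpleGraph Set

section
open scoped Classical

universe u

/-- In the multigraph on `W` whose edge `e` joins `s e` to `t e`, the edges with exactly one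
end in `A`. -/
noncomputable def multiCut {E W : Type*} [Fintype E] (s t : E → W) (A : Set W) : Finset E :=
  Finset.univ.filter fun e => ¬(s e ∈ A ↔ t e ∈ A)

/-- Perfect matchings of the multigraph on `W` whose edge `e` joins `s e` to `t e`. -/
def IsMultiPM {E W : Type*} [Fintype E] [DecidableEq E] (s t : E → W) (M : Finset E) : Prop :=
  (∀ e ∈ M, s e ≠ t e) ∧ ∀ v, (M ∩ multiCut s t {v}).card = 1

/-- The cone over Edmonds' fractional perfect matchings, at height `r`. -/
structure InPMCone {E W : Type*} [Fintype E] (s t : E → W) (x : E → ℝ) (r : ℝ) : Prop where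
  nonneg : ∀ e, 0 ≤ x e
  height_nonneg : 0 ≤ r
  vertex : ∀ v, ∑ e ∈ multiCut s t {v}, x e = r
  odd : ∀ A : Set W, Odd A.ncard → r ≤ ∑ e ∈ multiCut s t A, x e

/-- `x` agrees off loops with a nonnegative combination of perfect matchings. -/
def PMDecomposable {E : Type u} {W : Type*} [Fintype E] [DecidableEq E]
    (s t : E → W) (x : E → ℝ) : Prop :=
  ∃ (ι : Type u) (I : Finset ι) (c : ι → ℝ) (M : ι → Finset E),
    (∀ i ∈ I, 0 ≤ c i) ∧ (∀ i ∈ I, IsMultiPM s t (M i)) ∧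
      ∀ e, s e ≠ t e → ∑ i ∈ I, (if e ∈ M i then c i else 0) = x e

variable {E : Type u} {W : Type*} [Fintype E] {s t : E → W}

lemma mem_multiCut {A : Set W} {e : E} : e ∈ multiCut s t A ↔ ¬(s e ∈ A ↔ t e ∈ A) := by
  simp [multiCut]

lemma multiCut_compl (A : Set W) : multiCut s t Aᶜ = multiCut s t A := by
  ext e; simp only [mem_multiCut, Set.mem_compl_iff]; tauto

lemma ends_ne_of_mem_multiCut {A : Set W} {e : E} (h : e ∈ multiCut s t A) : s e ≠ t e := by
  intro h'; rw [mem_multiCut, h'] at h; exact h Iff.rfl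

lemma mem_multiCut_singleton {e : E} (he : s e ≠ t e) {v : W} :
    e ∈ multiCut s t {v} ↔ v ∈ s(s e, t e) := by
  rw [mem_multiCut, Sym2.mem_iff, Set.mem_singleton_iff, Set.mem_singleton_iff]
  constructor
  · intro h
    by_cases h1 : s e = v
    · exact Or.inl h1.symm
    · exact Or.inr (by tauto)
  · rintro (rfl | rfl)
    · simp [he.symm]
    · simp [he]

/-- Contract `U` to a single vertex. -/
noncomputable def contractMap (U : Set W) (v : W) : Option ↥Uᶜ :=
  if h : v ∈ U then none else some ⟨v, h⟩

lemma contractMap_preimage_none (U : Set W) : contractMap U ⁻¹' {none} = U := by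
  ext v; by_cases h : v ∈ U <;> simp [contractMap, h]

lemma contractMap_preimage_some (U : Set W) (v : ↥Uᶜ) :
    contractMap U ⁻¹' {some v} = {(v : W)} := by
  ext w
  by_cases h : w ∈ U
  · have : w ≠ v := fun h' => v.2 (h' ▸ h)
    simp [contractMap, h, this]
  · simp [contractMap, h, Subtype.ext_iff]

lemma odd_ncard_contractMap_preimage [Fintype W] {U : Set W} (hU : Odd U.ncard)
    {A : Set (Option ↥Uᶜ)} (hA : Odd A.ncard) : Odd (contractMap U ⁻¹' A).ncard := by
  have key : (contractMap U ⁻¹' A).toFinset.card =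
      ∑ a ∈ A.toFinset, ((contractMap U ⁻¹' A).toFinset.filter (contractMap U · = a)).card :=
    Finset.card_eq_sum_card_fiberwise (by intro v hv; simpa using hv)
  rw [Set.ncard_eq_toFinset_card', key, Finset.odd_sum_iff_odd_card_odd]
  rw [Set.ncard_eq_toFinset_card'] at hA
  convert hA using 2
  refine Finset.filter_true_of_mem fun a ha => ?_
  have h1 : (contractMap U ⁻¹' A).toFinset.filter (contractMap U · = a) =
      (contractMap U ⁻¹' {a}).toFinset := by
    ext v
    simp only [Finset.mem_filter, Set.mem_toFinset, Set.mem_preimage, Set.mem_singleton_iff]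
    constructor
    · exact fun h => h.2
    · rintro rfl; exact ⟨by simpa using ha, rfl⟩
  rw [h1, ← Set.ncard_eq_toFinset_card']
  cases a with
  | none => rwa [contractMap_preimage_none]
  | some v => rw [contractMap_preimage_some]; simp

lemma multiCut_contractMap (U : Set W) (A : Set (Option ↥Uᶜ)) :
    multiCut (contractMap U ∘ s) (contractMap U ∘ t) A = multiCut s t (contractMap U ⁻¹' A) :=
  rfl

lemma InPMCone.contract [Fintype W] {x : E → ℝ} {r : ℝ} (h : InPMCone s t x r) {U : Set W}
    (hU : Odd U.ncard) (htight : ∑ e ∈ multiCut s t U, x e = r) :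
    InPMCone (contractMap U ∘ s) (contractMap U ∘ t) x r where
  nonneg := h.nonneg
  height_nonneg := h.height_nonneg
  vertex v := by
    rw [multiCut_contractMap]
    cases v with
    | none => rwa [contractMap_preimage_none]
    | some v => rw [contractMap_preimage_some]; exact h.vertex v
  odd A hA := by
    rw [multiCut_contractMap]
    exact h.odd _ (odd_ncard_contractMap_preimage hU hA)

lemma card_contract_lt_s8 [Fintype W] {U : Set W} (hU : 1 < U.ncard) :
    Nat.card (Option ↥Uᶜ) < Nat.card W := by
  have h := Set.ncard_add_ncard_compl U
  rw [Finite.card_option, Nat.card_coe_set_eq]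
  omega

variable [DecidableEq E]

lemma IsMultiPM.card_inter_multiCut {U : Set W} {M : Finset E}
    (h : IsMultiPM (contractMap U ∘ s) (contractMap U ∘ t) M) :
    (M ∩ multiCut s t U).card = 1 := by
  have := h.2 none
  rwa [multiCut_contractMap, contractMap_preimage_none] at this

lemma IsMultiPM.card_inter_vertex {U : Set W} {M : Finset E}
    (h : IsMultiPM (contractMap U ∘ s) (contractMap U ∘ t) M) {v : W} (hv : v ∉ U) :
    (M ∩ multiCut s t {v}).card = 1 := by
  have := h.2 (some ⟨v, hv⟩)
  rwa [multiCut_contractMap, contractMap_preimage_some] at this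

lemma IsMultiPM.not_inside {U : Set W} {M : Finset E}
    (h : IsMultiPM (contractMap U ∘ s) (contractMap U ∘ t) M) {e : E} (he : e ∈ M)
    (hs : s e ∈ U) : t e ∉ U := by
  intro ht
  exact h.1 e he (by simp [contractMap, hs, ht])

lemma IsMultiPM.card_union_inter_vertex {U : Set W} {M N : Finset E}
    (hM : IsMultiPM (contractMap U ∘ s) (contractMap U ∘ t) M)
    (hN : IsMultiPM (contractMap Uᶜ ∘ s) (contractMap Uᶜ ∘ t) N)
    {e : E} (he : e ∈ multiCut s t U) (heM : e ∈ M) (heN : e ∈ N) {v : W} (hv : v ∉ U) :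
    ((M ∪ N) ∩ multiCut s t {v}).card = 1 := by
  rw [← hM.card_inter_vertex hv]
  congr 1
  ext f
  simp only [Finset.mem_inter, Finset.mem_union]
  refine ⟨?_, fun h => ⟨Or.inl h.1, h.2⟩⟩
  rintro ⟨hf | hf, hfv⟩
  · exact ⟨hf, hfv⟩
  · refine ⟨?_, hfv⟩
    have hfU : f ∈ multiCut s t U := by
      have h1 : ¬(s f ∉ U ∧ t f ∉ U) := fun h => hN.not_inside hf h.1 h.2
      rw [mem_multiCut] at hfv ⊢
      simp only [Set.mem_singleton_iff] at hfv
      intro h2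
      have h3 : s f = v ∨ t f = v := by tauto
      rcases h3 with h3 | h3 <;> subst h3 <;> tauto
    have h1 := hN.card_inter_multiCut
    rw [multiCut_compl] at h1
    have : f = e := Finset.card_le_one.1 h1.le f (Finset.mem_inter.2 ⟨hf, hfU⟩) e
      (Finset.mem_inter.2 ⟨heN, he⟩)
    rwa [this]

lemma IsMultiPM.glue {U : Set W} {M N : Finset E}
    (hM : IsMultiPM (contractMap U ∘ s) (contractMap U ∘ t) M)
    (hN : IsMultiPM (contractMap Uᶜ ∘ s) (contractMap Uᶜ ∘ t) N)
    {e : E} (he : e ∈ multiCut s t U) (heM : e ∈ M) (heN : e ∈ N) :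
    IsMultiPM s t (M ∪ N) := by
  refine ⟨fun f hf hne => ?_, fun v => ?_⟩
  · rcases Finset.mem_union.1 hf with hf | hf
    · exact hM.1 f hf (congrArg _ hne)
    · exact hN.1 f hf (congrArg _ hne)
  · by_cases hv : v ∈ U
    · rw [Finset.union_comm]
      refine hN.card_union_inter_vertex (by rwa [compl_compl U]) (e := e) ?_ heN heM (by simpa)
      rwa [multiCut_compl]
    · exact hM.card_union_inter_vertex hN he heM heN hv

/-- The total weight, in the coupling of two weighted families agreeing on `D`, of the pairs
whose first component contains `f`. -/
lemma sum_coupling {E ι κ : Type*} [DecidableEq E] {I : Finset ι} {J : Finset κ}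
    {c : ι → ℝ} {d : κ → ℝ}
    {M : ι → Finset E} {N : κ → Finset E} {D : Finset E} {x : E → ℝ}
    (hc : ∀ i ∈ I, 0 ≤ c i)
    (hM : ∀ i ∈ I, (M i ∩ D).card = 1)
    (hMx : ∀ e ∈ D, ∑ i ∈ I, (if e ∈ M i then c i else 0) = x e)
    (hNx : ∀ e ∈ D, ∑ j ∈ J, (if e ∈ N j then d j else 0) = x e) (f : E) :
    ∑ e ∈ D, ∑ i ∈ I, ∑ j ∈ J, (if e ∈ M i ∧ e ∈ N j ∧ f ∈ M i then c i * d j / x e else 0) =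
      ∑ i ∈ I, (if f ∈ M i then c i else 0) := by
  have h1 : ∀ e ∈ D, ∀ i ∈ I,
      ∑ j ∈ J, (if e ∈ M i ∧ e ∈ N j ∧ f ∈ M i then c i * d j / x e else 0) =
      if e ∈ M i then (if f ∈ M i then c i else 0) else 0 := by
    intro e he i hi
    by_cases hei : e ∈ M i
    · by_cases hfi : f ∈ M i
      · simp only [hei, hfi, true_and, and_true, if_true]
        have : ∀ j ∈ J, (if e ∈ N j then c i * d j / x e else 0) =
            c i / x e * (if e ∈ N j then d j else 0) := by
          intro j _; split_ifs <;> ring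
        rw [Finset.sum_congr rfl this, ← Finset.mul_sum, hNx e he]
        by_cases hx : x e = 0
        · have h0 := hMx e he
          rw [hx, Finset.sum_eq_zero_iff_of_nonneg] at h0
          · have := h0 i hi
            rw [if_pos hei] at this
            simp [this]
          · intro k hk; split_ifs
            exacts [hc k hk, le_rfl]
        · field_simp
      · simp [hfi]
    · simp [hei]
  rw [Finset.sum_congr rfl fun e he => Finset.sum_congr rfl (h1 e he), Finset.sum_comm]
  refine Finset.sum_congr rfl fun i hi => ?_
  rw [← Finset.sum_filter, Finset.sum_const, Finset.filter_mem_eq_inter, Finset.inter_comm, hM i hi,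
    one_smul]

lemma PMDecomposable.glue {x : E → ℝ} {U : Set W} (hx : ∀ e, 0 ≤ x e)
    (h₁ : PMDecomposable (contractMap U ∘ s) (contractMap U ∘ t) x)
    (h₂ : PMDecomposable (contractMap Uᶜ ∘ s) (contractMap Uᶜ ∘ t) x) :
    PMDecomposable s t x := by
  obtain ⟨ι, I, c, M, hc, hM, hMx⟩ := h₁
  obtain ⟨κ, J, d, N, hd, hN, hNx⟩ := h₂
  set D := multiCut s t U with hD
  have hM1 : ∀ i ∈ I, (M i ∩ D).card = 1 := fun i hi => (hM i hi).card_inter_multiCut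
  have hN1 : ∀ j ∈ J, (N j ∩ D).card = 1 := fun j hj => by
    rw [hD, ← multiCut_compl]; exact (hN j hj).card_inter_multiCut
  have hMx' : ∀ e, ¬(s e ∈ U ∧ t e ∈ U) → s e ≠ t e →
      ∑ i ∈ I, (if e ∈ M i then c i else 0) = x e := fun e he hne => by
    refine hMx e fun h => ?_
    by_cases h1 : s e ∈ U <;> by_cases h2 : t e ∈ U <;> simp_all [contractMap]
  have hNx' : ∀ e, ¬(s e ∉ U ∧ t e ∉ U) → s e ≠ t e →
      ∑ j ∈ J, (if e ∈ N j then d j else 0) = x e := fun e he hne => by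
    refine hNx e fun h => ?_
    by_cases h1 : s e ∈ U <;> by_cases h2 : t e ∈ U <;> simp_all [contractMap]
  have hMD : ∀ e ∈ D, ∑ i ∈ I, (if e ∈ M i then c i else 0) = x e := fun e he =>
    hMx' e (by rw [hD, mem_multiCut] at he; tauto) (ends_ne_of_mem_multiCut he)
  have hND : ∀ e ∈ D, ∑ j ∈ J, (if e ∈ N j then d j else 0) = x e := fun e he =>
    hNx' e (by rw [hD, mem_multiCut] at he; tauto) (ends_ne_of_mem_multiCut he)
  refine ⟨E × ι × κ, (D ×ˢ I ×ˢ J).filter (fun p => p.1 ∈ M p.2.1 ∧ p.1 ∈ N p.2.2),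
    fun p => c p.2.1 * d p.2.2 / x p.1, fun p => M p.2.1 ∪ N p.2.2, ?_, ?_, ?_⟩
  · rintro ⟨e, i, j⟩ h
    simp only [Finset.mem_filter, Finset.mem_product] at h
    exact div_nonneg (mul_nonneg (hc i h.1.2.1) (hd j h.1.2.2)) (hx e)
  · rintro ⟨e, i, j⟩ h
    simp only [Finset.mem_filter, Finset.mem_product] at h
    exact (hM i h.1.2.1).glue (hN j h.1.2.2) h.1.1 h.2.1 h.2.2
  · intro f hf
    rw [Finset.sum_filter, Finset.sum_product]
    simp_rw [Finset.sum_product]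
    by_cases hfM : s f ∈ U ∧ t f ∈ U
    · rw [← hNx' f (by tauto) hf, ← sum_coupling hd hN1 hND hMD f]
      refine Finset.sum_congr rfl fun e _ => ?_
      rw [Finset.sum_comm]
      refine Finset.sum_congr rfl fun j _ => Finset.sum_congr rfl fun i hi => ?_
      have : f ∉ M i := fun h => (hM i hi).not_inside h hfM.1 hfM.2
      simp only [Finset.mem_union, this, false_or, ← ite_and]
      rw [mul_comm]
      exact if_congr (by tauto) rfl rfl
    · rw [← hMx' f hfM hf, ← sum_coupling hc hM1 hMD hND f]
      refine Finset.sum_congr rfl fun e he =>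
        Finset.sum_congr rfl fun i hi => Finset.sum_congr rfl fun j hj => ?_
      rw [← ite_and]
      refine if_congr ?_ rfl rfl
      rw [Finset.mem_union]
      suffices h : e ∈ M i → f ∈ N j → e ∈ N j → f ∈ M i by tauto
      intro hei hfj hej
      have hfD : f ∈ D := by
        have := (hN j hj).not_inside hfj
        simp only [Set.mem_compl_iff] at this
        rw [hD, mem_multiCut]; tauto
      rwa [Finset.card_le_one.1 (hN1 j hj).le f (Finset.mem_inter.2 ⟨hfj, hfD⟩) e
        (Finset.mem_inter.2 ⟨hej, he⟩)]


/-- The simple graph of the edges of positive weight. -/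
def supportGraph (s t : E → W) (x : E → ℝ) : SimpleGraph W where
  Adj u v := u ≠ v ∧ ∃ e, 0 < x e ∧ s(s e, t e) = s(u, v)
  symm := ⟨fun u v h => ⟨h.1.symm, by simpa only [Sym2.eq_swap (a := v)] using h.2⟩⟩
  loopless := ⟨fun u h => h.1 rfl⟩

lemma not_isTutteViolator_supportGraph [Fintype W] {x : E → ℝ} {r : ℝ} (h : InPMCone s t x r)
    (hr : 0 < r) (u : Set W) : ¬(supportGraph s t x).IsTutteViolator u := by
  rw [SimpleGraph.IsTutteViolator, not_lt]
  set K := ((⊤ : (supportGraph s t x).Subgraph).deleteVerts u).coe with hK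
  let B : K.ConnectedComponent → Set W := fun C => Subtype.val '' C.supp
  have hBodd : ∀ C ∈ K.oddComponents, Odd (B C).ncard := fun C hC => by
    rw [Set.ncard_image_of_injective _ Subtype.val_injective]; exact hC
  have hcount : ∀ e, 0 < x e →
      (K.oddComponents.toFinset.filter fun C => e ∈ multiCut s t (B C)).card ≤
        (u.toFinset.filter fun v => e ∈ multiCut s t {v}).card := by
    intro e he
    have main : ∀ C a b, s(s e, t e) = s(a, b) → a ∈ B C → b ∉ B C → b ∈ u := by
      rintro C a b hab ⟨a', ha', rfl⟩ hb
      by_contra hbu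
      have hbK : b ∈ ((⊤ : (supportGraph s t x).Subgraph).deleteVerts u).verts := by simp [hbu]
      refine hb ⟨⟨b, hbK⟩, ?_, rfl⟩
      have hadj : K.Adj a' ⟨b, hbK⟩ := by
        have ha := a'.2
        simp only [SimpleGraph.Subgraph.deleteVerts_verts, Set.mem_sdiff] at ha
        simp only [hK, SimpleGraph.Subgraph.coe_adj, SimpleGraph.Subgraph.deleteVerts_adj,
          SimpleGraph.Subgraph.top_adj]
        refine ⟨ha.1, ha.2, trivial, hbu, fun h => hb (h ▸ ⟨a', ha', rfl⟩), e, he, hab⟩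
      exact (C.mem_supp_congr_adj hadj).1 ha'
    have hdisj : ∀ C, ∀ a ∈ B C, a ∉ u := by
      rintro C _ ⟨a, _, rfl⟩
      have := a.2
      simp only [SimpleGraph.Subgraph.deleteVerts_verts, Set.mem_sdiff] at this
      exact this.2
    have huniq : ∀ C C' a, a ∈ B C → a ∈ B C' → C = C' := by
      rintro C C' _ ⟨a, ha, rfl⟩ ⟨a', ha', h⟩
      obtain rfl := Subtype.val_injective h
      exact SimpleGraph.ConnectedComponent.eq_of_common_vertex ha ha'
    rcases Finset.eq_empty_or_nonempty
      (K.oddComponents.toFinset.filter fun C => e ∈ multiCut s t (B C)) with h0 | ⟨C, hC⟩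
    · rw [h0]; simp
    · have hcut : ∀ C, e ∈ multiCut s t (B C) →
          ∃ a b, s(s e, t e) = s(a, b) ∧ a ∈ B C ∧ b ∉ B C := by
        intro C hC
        rw [mem_multiCut] at hC
        by_cases h1 : s e ∈ B C
        · exact ⟨_, _, rfl, h1, by tauto⟩
        · exact ⟨_, _, Sym2.eq_swap, by tauto, h1⟩
      obtain ⟨a, b, hab, ha, hb⟩ := hcut C (Finset.mem_filter.1 hC).2
      have hbu := main C a b hab ha hb
      have hanu := hdisj C a ha
      refine (Finset.card_le_one.2 ?_ : _ ≤ 1).trans (Finset.card_pos.2 ⟨b, ?_⟩)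
      · have key : ∀ C', e ∈ multiCut s t (B C') → C' = C := by
          intro C' hC'
          obtain ⟨a', b', hab', ha', hb'⟩ := hcut C' hC'
          rw [hab, Sym2.eq_iff] at hab'
          rcases hab' with ⟨rfl, rfl⟩ | ⟨rfl, rfl⟩
          · exact huniq _ _ _ ha' ha
          · exact absurd hbu (hdisj C' _ ha')
        intro C₁ h₁ C₂ h₂
        rw [key C₁ (Finset.mem_filter.1 h₁).2, key C₂ (Finset.mem_filter.1 h₂).2]
      · rw [Finset.mem_filter]
        refine ⟨by simpa using hbu, ?_⟩
        rw [mem_multiCut]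
        have hne : a ≠ b := fun h => hanu (h ▸ hbu)
        rcases Sym2.eq_iff.1 hab with ⟨h1, h2⟩ | ⟨h1, h2⟩ <;> simp [h1, h2, hne]
  have hsum : ∀ {α : Type _} (S : Finset α) (T : α → Set W),
      ∑ C ∈ S, ∑ e ∈ multiCut s t (T C), x e =
        ∑ e, (S.filter fun C => e ∈ multiCut s t (T C)).card * x e := by
    intro α S T
    have : ∀ C ∈ S, ∑ e ∈ multiCut s t (T C), x e =
        ∑ e, if e ∈ multiCut s t (T C) then x e else 0 := by
      intro C _
      rw [← Finset.sum_filter, Finset.filter_univ_mem]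
    rw [Finset.sum_congr rfl this, Finset.sum_comm]
    refine Finset.sum_congr rfl fun e _ => ?_
    rw [← Finset.sum_filter, Finset.sum_const, nsmul_eq_mul]
  have h1 : K.oddComponents.toFinset.card * r ≤
      ∑ C ∈ K.oddComponents.toFinset, ∑ e ∈ multiCut s t (B C), x e := by
    rw [← nsmul_eq_mul]
    exact Finset.card_nsmul_le_sum _ _ _ fun C hC => h.odd _ (hBodd C (by simpa using hC))
  have h2 : ∑ v ∈ u.toFinset, ∑ e ∈ multiCut s t {v}, x e = u.toFinset.card * r := by
    rw [Finset.sum_congr rfl fun v _ => h.vertex v, Finset.sum_const, nsmul_eq_mul]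
  have h3 : ∑ C ∈ K.oddComponents.toFinset, ∑ e ∈ multiCut s t (B C), x e ≤
      ∑ v ∈ u.toFinset, ∑ e ∈ multiCut s t {v}, x e := by
    have e1 := hsum K.oddComponents.toFinset B
    have e2 := hsum u.toFinset fun v => {v}
    rw [e1, e2]
    refine Finset.sum_le_sum fun e _ => ?_
    rcases (h.nonneg e).eq_or_lt with h0 | h0
    · simp [← h0]
    · exact mul_le_mul_of_nonneg_right (by exact_mod_cast hcount e h0) h0.le
  have h4 := le_of_mul_le_mul_right ((h1.trans h3).trans h2.le) hr
  rw [Set.ncard_eq_toFinset_card', Set.ncard_eq_toFinset_card']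
  exact_mod_cast h4

lemma InPMCone.exists_isMultiPM [Fintype W] {x : E → ℝ} {r : ℝ} (h : InPMCone s t x r)
    (hr : 0 < r) : ∃ M, IsMultiPM s t M ∧ ∀ e ∈ M, 0 < x e := by
  obtain ⟨P, hP⟩ := SimpleGraph.tutte.2 (not_isTutteViolator_supportGraph h hr)
  have hex : ∀ p ∈ P.edgeSet, ∃ e, 0 < x e ∧ s(s e, t e) = p := by
    intro p
    induction p with
    | h a b => exact fun hp => (P.adj_sub hp).2
  rcases isEmpty_or_nonempty E with hE | hE
  · exact ⟨∅, ⟨by simp, fun v => absurd (h.vertex v) (by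
      rw [Finset.eq_empty_of_isEmpty (multiCut s t {v}), Finset.sum_empty]; exact hr.ne)⟩, by simp⟩
  choose! f hf0 hf using hex
  refine ⟨Finset.univ.filter fun e => s(s e, t e) ∈ P.edgeSet ∧ f s(s e, t e) = e,
    ⟨?_, ?_⟩, ?_⟩
  · intro e he hne
    have := (Finset.mem_filter.1 he).2.1
    rw [SimpleGraph.Subgraph.mem_edgeSet] at this
    exact this.ne hne
  · intro v
    obtain ⟨w, hw, hwu⟩ := SimpleGraph.Subgraph.isPerfectMatching_iff.1 hP v
    have hp : s(v, w) ∈ P.edgeSet := hw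
    have hvw : v ≠ w := hw.ne
    rw [Finset.card_eq_one]
    refine ⟨f s(v, w), ?_⟩
    ext e
    simp only [Finset.mem_inter, Finset.mem_filter, Finset.mem_univ, true_and,
      Finset.mem_singleton, mem_multiCut, Set.mem_singleton_iff]
    constructor
    · rintro ⟨⟨h1, h2⟩, h3⟩
      rw [← h2]
      congr 1
      by_cases h4 : s e = v
      · rw [h4] at h1 ⊢
        rw [show t e = w from hwu _ h1]
      · have h5 : t e = v := by tauto
        rw [h5, Sym2.eq_swap] at h1 ⊢
        rw [show s e = w from hwu _ h1]
    · rintro rfl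
      rw [hf _ hp]
      refine ⟨⟨hp, rfl⟩, ?_⟩
      rcases Sym2.eq_iff.1 (hf _ hp) with ⟨h1, h2⟩ | ⟨h1, h2⟩ <;> simp [h1, h2, hvw.symm]
  · intro e he
    have := (Finset.mem_filter.1 he).2
    rw [← this.2]; exact hf0 _ this.1

lemma PMDecomposable.add_smul {x y : E → ℝ} {ε : ℝ} {N : Finset E} (hε : 0 ≤ ε)
    (hN : IsMultiPM s t N) (hy : PMDecomposable s t y)
    (hxy : ∀ e, x e = y e + if e ∈ N then ε else 0) : PMDecomposable s t x := by
  obtain ⟨ι, I, c, M, hc, hM, hMy⟩ := hy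
  refine ⟨Option ι, Finset.insertNone I, fun i => i.elim ε c, fun i => i.elim N M, ?_, ?_, ?_⟩
  · rw [Finset.forall_mem_insertNone]; exact ⟨hε, hc⟩
  · rw [Finset.forall_mem_insertNone]; exact ⟨hN, hM⟩
  · intro e he
    rw [Finset.sum_insertNone, hxy, ← hMy e he, add_comm]
    rfl

lemma sum_sub_smul {E : Type*} [DecidableEq E] (D N : Finset E) (x : E → ℝ) (ε : ℝ) :
    ∑ e ∈ D, (x e - if e ∈ N then ε else 0) = ∑ e ∈ D, x e - (N ∩ D).card * ε := by
  rw [Finset.sum_sub_distrib, ← Finset.sum_filter, Finset.sum_const, nsmul_eq_mul,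
    Finset.filter_mem_eq_inter, Finset.inter_comm]

/-- Edmonds' perfect matching polytope theorem, in conic form. -/
theorem InPMCone.pmDecomposable [Fintype W] {x : E → ℝ} {r : ℝ} (h : InPMCone s t x r) :
    PMDecomposable s t x := by
  induction hn : Nat.card W using Nat.strong_induction_on generalizing W x r with
  | _ n ihW =>
  subst hn
  have tight : ∀ {y : E → ℝ} {q : ℝ}, InPMCone s t y q → ∀ U : Set W, Odd U.ncard →
      1 < U.ncard → Odd Uᶜ.ncard → 1 < Uᶜ.ncard → ∑ e ∈ multiCut s t U, y e = q →
      PMDecomposable s t y := by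
    intro y q hy U hU hU1 hUc hUc1 hq
    refine PMDecomposable.glue hy.nonneg (ihW _ (card_contract_lt_s8 hU1) (hy.contract hU hq) rfl)
      (ihW _ (card_contract_lt_s8 hUc1) (hy.contract hUc ?_) rfl)
    rwa [multiCut_compl]
  induction hm : (Finset.univ.filter fun e => 0 < x e).card using Nat.strong_induction_on
    generalizing x r with
  | _ m ihm =>
  subst hm
  rcases isEmpty_or_nonempty W with hW | ⟨⟨v₀⟩⟩
  · exact ⟨PEmpty, ∅, fun _ => 0, fun _ => ∅, by simp, by simp, fun e => (hW.false (s e)).elim⟩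
  have hle : ∀ e, s e ≠ t e → x e ≤ r := by
    intro e he
    rw [← h.vertex (s e)]
    refine Finset.single_le_sum (fun e _ => h.nonneg e) ?_
    simp [mem_multiCut, he.symm]
  rcases h.height_nonneg.eq_or_lt with hr | hr
  · refine ⟨PEmpty, ∅, fun _ => 0, fun _ => ∅, by simp, by simp, fun e he => ?_⟩
    have := hle e he
    have := h.nonneg e
    simp; linarith
  obtain ⟨M, hM, hMx⟩ := h.exists_isMultiPM hr
  have hMne : M.Nonempty := by
    obtain ⟨e, he⟩ := Finset.card_pos.1 (by rw [hM.2 v₀]; exact one_pos)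
    exact ⟨e, (Finset.mem_inter.1 he).1⟩
  obtain ⟨e₀, he₀, hmin⟩ := M.exists_min_image x hMne
  have hreduce : ∀ ε, 0 ≤ ε → ε ≤ x e₀ →
      (∀ A : Set W, Odd A.ncard → r - ε ≤ ∑ e ∈ multiCut s t A, x e -
        (M ∩ multiCut s t A).card * ε) →
      InPMCone s t (fun e => x e - if e ∈ M then ε else 0) (r - ε) := by
    intro ε hε0 hε hA
    refine ⟨fun e => ?_, ?_, fun v => ?_, fun A hodd => ?_⟩
    · split_ifs with he
      · linarith [hmin e he]
      · simpa using h.nonneg e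
    · linarith [hle e₀ (hM.1 e₀ he₀)]
    · rw [sum_sub_smul, h.vertex, hM.2]; simp
    · rw [sum_sub_smul]; exact hA A hodd
  by_cases hgood : ∀ A : Set W, Odd A.ncard → r - x e₀ ≤ ∑ e ∈ multiCut s t A, x e -
        (M ∩ multiCut s t A).card * x e₀
  · have hy := hreduce (x e₀) (h.nonneg e₀) le_rfl hgood
    refine PMDecomposable.add_smul (h.nonneg e₀) hM (ihm _ ?_ hy rfl) (fun e => by ring)
    refine Finset.card_lt_card ⟨?_, ?_⟩
    · intro e he
      simp only [Finset.mem_filter, Finset.mem_univ, true_and] at he ⊢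
      split_ifs at he with heM
      · exact hMx e heM
      · linarith
    · intro hsub
      have := hsub (x := e₀) (by simpa using hMx e₀ he₀)
      simp [he₀] at this
  · push Not at hgood
    obtain ⟨A₁, hA₁, hlt⟩ := hgood
    have hslack : ∀ A : Set W, Odd A.ncard → 0 ≤ ∑ e ∈ multiCut s t A, x e - r :=
      fun A hA => sub_nonneg.2 (h.odd A hA)
    have hx₀ := hMx e₀ he₀
    have hk₁ : (1 : ℝ) < (M ∩ multiCut s t A₁).card := by
      by_contra hk
      nlinarith [hslack A₁ hA₁]
    let bad : Finset (Set W) := Finset.univ.filter fun A =>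
      Odd A.ncard ∧ (1 : ℝ) < (M ∩ multiCut s t A).card
    obtain ⟨A, hA, hAmin⟩ := bad.exists_min_image
      (fun A => (∑ e ∈ multiCut s t A, x e - r) / ((M ∩ multiCut s t A).card - 1))
      ⟨A₁, Finset.mem_filter.2 ⟨Finset.mem_univ _, hA₁, hk₁⟩⟩
    obtain ⟨hAodd, hAk⟩ := (Finset.mem_filter.1 hA).2
    set ε := (∑ e ∈ multiCut s t A, x e - r) / ((M ∩ multiCut s t A).card - 1) with hε
    have hε0 : 0 ≤ ε := div_nonneg (hslack A hAodd) (by linarith)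
    have hε1 : ε < x e₀ := by
      refine (hAmin A₁ (Finset.mem_filter.2 ⟨Finset.mem_univ _, hA₁, hk₁⟩)).trans_lt ?_
      rw [div_lt_iff₀ (by linarith)]
      nlinarith
    have hεA : ε * ((M ∩ multiCut s t A).card - 1) = ∑ e ∈ multiCut s t A, x e - r :=
      div_mul_cancel₀ _ (by linarith)
    have hy := hreduce ε hε0 hε1.le (by
      intro A' hA'
      by_cases hk : (1 : ℝ) < (M ∩ multiCut s t A').card
      · have := hAmin A' (Finset.mem_filter.2 ⟨Finset.mem_univ _, hA', hk⟩)
        rw [le_div_iff₀ (by linarith)] at this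
        linarith
      · nlinarith [hslack A' hA'])
    have hWeven : ¬Odd (Nat.card W) := by
      intro hodd
      have := h.odd Set.univ (by rwa [Set.ncard_univ])
      have h0 : multiCut s t Set.univ = ∅ := by ext; simp [mem_multiCut]
      rw [h0] at this
      simp at this
      linarith
    have hAc : Odd Aᶜ.ncard := by
      have := Set.ncard_add_ncard_compl A
      rw [← this, Nat.odd_add] at hWeven
      rw [← Nat.not_even_iff_odd]
      tauto
    have hbig : ∀ B : Set W, Odd B.ncard → (1 : ℝ) < (M ∩ multiCut s t B).card →
        1 < B.ncard := by
      intro B hB hBk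
      by_contra hcon
      have : B.ncard = 1 := by have := hB.pos; omega
      obtain ⟨v, rfl⟩ := Set.ncard_eq_one.1 this
      rw [hM.2] at hBk
      simp at hBk
    refine PMDecomposable.add_smul hε0 hM (tight hy A hAodd (hbig A hAodd hAk) hAc
      (hbig _ hAc (by rwa [multiCut_compl])) ?_) (fun e => by ring)
    rw [sum_sub_smul]
    linarith

lemma sum_card_inter_multiCut_singleton (F : Finset E) (B : Finset W) :
    ∑ v ∈ B, (F ∩ multiCut s t {v}).card =
      ∑ e ∈ F, (B.filter fun v => e ∈ multiCut s t {v}).card := by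
  refine (Finset.sum_congr rfl fun v _ => ?_).trans
    (Finset.sum_card_bipartiteAbove_eq_sum_card_bipartiteBelow fun v e => e ∈ multiCut s t {v})
  rw [Finset.bipartiteAbove, Finset.filter_mem_eq_inter]

lemma filter_mem_multiCut_singleton {e : E} (he : s e ≠ t e) (B : Finset W) :
    (B.filter fun v => e ∈ multiCut s t {v}) = ({s e, t e} : Finset W).filter (· ∈ B) := by
  ext v
  simp only [Finset.mem_filter, mem_multiCut_singleton he, Sym2.mem_iff, Finset.mem_insert,
    Finset.mem_singleton]
  tauto

lemma sum_card_inter_multiCut_singleton_univ [Fintype W] {F : Finset E}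
    (hF : ∀ e ∈ F, s e ≠ t e) :
    ∑ v, (F ∩ multiCut s t {v}).card = F.card * 2 := by
  rw [sum_card_inter_multiCut_singleton, ← smul_eq_mul, ← Finset.sum_const]
  refine Finset.sum_congr rfl fun e he => ?_
  rw [filter_mem_multiCut_singleton (hF e he)]
  simp [Finset.card_pair (hF e he)]

lemma odd_card_inter_multiCut [Fintype W] {F : Finset E} (hF : ∀ e ∈ F, s e ≠ t e)
    (hdeg : ∀ v, Odd (F ∩ multiCut s t {v}).card) {A : Set W} (hA : Odd A.ncard) :
    Odd (F ∩ multiCut s t A).card := by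
  have h1 : Odd (∑ v ∈ A.toFinset, (F ∩ multiCut s t {v}).card) := by
    rw [Finset.odd_sum_iff_odd_card_odd, Finset.filter_true_of_mem fun v _ => hdeg v]
    rwa [← Set.ncard_eq_toFinset_card']
  rw [sum_card_inter_multiCut_singleton, Finset.odd_sum_iff_odd_card_odd] at h1
  convert h1 using 2
  rw [← Finset.filter_mem_eq_inter]
  refine Finset.filter_congr fun e he => ?_
  rw [filter_mem_multiCut_singleton (hF e he), Finset.filter_insert, Finset.filter_singleton,
    mem_multiCut]
  have := hF e he
  by_cases h1 : s e ∈ A <;> by_cases h2 : t e ∈ A <;> simp [h1, h2, this]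

/-- A perfect matching in the support of an element of the cone meets a given edge set `N` in at
most its average weight. -/
lemma InPMCone.exists_isMultiPM_card_inter_le [Fintype W] [Nonempty W] {x : E → ℝ} {r : ℝ}
    (h : InPMCone s t x r) (hr : 0 < r) {N : Finset E} (hN : ∀ e ∈ N, s e ≠ t e) :
    ∃ M, IsMultiPM s t M ∧ (∀ e ∈ M, 0 < x e) ∧ (N ∩ M).card * r ≤ ∑ e ∈ N, x e := by
  obtain ⟨ι, I, c, M, hc, hM, hMx⟩ := h.pmDecomposable
  have hsum : ∀ D : Finset E, (∀ e ∈ D, s e ≠ t e) →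
      ∑ i ∈ I, (D ∩ M i).card * c i = ∑ e ∈ D, x e := by
    intro D hD
    rw [← Finset.sum_congr rfl fun e he => hMx e (hD e he), Finset.sum_comm]
    refine Finset.sum_congr rfl fun i _ => ?_
    rw [← Finset.sum_filter, Finset.sum_const, nsmul_eq_mul, Finset.filter_mem_eq_inter]
  have htotal : ∑ i ∈ I, c i = r := by
    obtain ⟨v⟩ := ‹Nonempty W›
    rw [← h.vertex v, ← hsum _ fun e he => ends_ne_of_mem_multiCut he]
    refine Finset.sum_congr rfl fun i hi => ?_
    rw [Finset.inter_comm, (hM i hi).2 v]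
    simp
  obtain ⟨i, hi, hci, hle⟩ : ∃ i ∈ I, 0 < c i ∧ (N ∩ M i).card * r ≤ ∑ e ∈ N, x e := by
    by_contra! hcon
    have hpos : ∃ i ∈ I, 0 < c i := by
      by_contra! h0
      linarith [Finset.sum_nonpos h0]
    have : ∑ i ∈ I, c i * ∑ e ∈ N, x e < ∑ i ∈ I, c i * ((N ∩ M i).card * r) := by
      refine Finset.sum_lt_sum (fun i hi => ?_) ?_
      · rcases (hc i hi).eq_or_lt with h0 | h0
        · simp [← h0]
        · exact (mul_lt_mul_of_pos_left (hcon i hi h0) h0).le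
      · obtain ⟨i, hi, h0⟩ := hpos
        exact ⟨i, hi, mul_lt_mul_of_pos_left (hcon i hi h0) h0⟩
    rw [← Finset.sum_mul, htotal, ← hsum N hN, Finset.mul_sum] at this
    exact this.ne (Finset.sum_congr rfl fun i _ => by ring)
  refine ⟨M i, hM i hi, fun e he => hci.trans_le ?_, hle⟩
  rw [← hMx e ((hM i hi).1 e he)]
  refine (if_pos he).symm.le.trans
    (Finset.single_le_sum (f := fun i => if e ∈ M i then c i else 0) (fun j hj => ?_) hi)
  split_ifs
  exacts [hc j hj, le_rfl]

lemma edgeCut_ncard_ne_one {V : Type*} {G : SimpleGraph V} (h : Bridgeless G) (A : Set V) :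
    (edgeCut G A).ncard ≠ 1 := by
  intro h1
  obtain ⟨e, he⟩ := Set.ncard_eq_one.1 h1
  obtain ⟨-, u, v, rfl, hu, hv⟩ : e ∈ edgeCut G A := by rw [he]; rfl
  refine h s(u, v) (SimpleGraph.isBridge_iff.2 ?_)
  rintro ⟨p⟩
  obtain ⟨d, -, hd1, hd2⟩ := p.exists_boundary_dart A hu hv
  have hd := d.adj
  rw [SimpleGraph.deleteEdges_adj] at hd
  exact hd.2 (he.subset ⟨hd.1, _, _, rfl, hd1, hd2⟩)

lemma coe_inter_multiCut {V : Type*} [Fintype V] {G : SimpleGraph V} {s t : Sym2 V → V}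
    (hst : ∀ e, s(s e, t e) = e) (A : Set V) :
    ((G.edgeFinset ∩ multiCut s t A : Finset (Sym2 V)) : Set (Sym2 V)) = edgeCut G A := by
  ext e
  rw [Finset.mem_coe, Finset.mem_inter, SimpleGraph.mem_edgeFinset, mem_multiCut]
  refine and_congr_right fun _ => ⟨fun h => ?_, ?_⟩
  · by_cases h1 : s e ∈ A
    · exact ⟨_, _, (hst e).symm, h1, by tauto⟩
    · exact ⟨_, _, (hst e).symm.trans Sym2.eq_swap, by tauto, h1⟩
  · rintro ⟨u, v, huv, hu, hv⟩
    have h := hst e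
    nth_rw 3 [huv] at h
    rcases Sym2.eq_iff.1 h with ⟨h1, h2⟩ | ⟨h1, h2⟩ <;> simp [h1, h2, hu, hv]

lemma ends_ne_of_mem_edgeSet {V : Type*} {G : SimpleGraph V} {s t : Sym2 V → V}
    (hst : ∀ e, s(s e, t e) = e) {e : Sym2 V} (he : e ∈ G.edgeSet) : s e ≠ t e := by
  rw [← hst e, SimpleGraph.mem_edgeSet] at he
  exact he.ne

lemma isMultiPM_iff_isPerfectMatchingSet {V : Type*} [Fintype V] {G : SimpleGraph V}
    {s t : Sym2 V → V} (hst : ∀ e, s(s e, t e) = e) {M : Finset (Sym2 V)} (hMG : ∀ e ∈ M, e ∈ G.edgeSet) :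
    IsMultiPM s t M ↔ IsPerfectMatchingSet G (M : Set (Sym2 V)) := by
  have hne : ∀ e ∈ M, s e ≠ t e := fun e he => ends_ne_of_mem_edgeSet hst (hMG e he)
  refine ⟨fun h => ⟨hMG, fun v => ?_⟩, fun h => ⟨hne, fun v => ?_⟩⟩
  · obtain ⟨e, he⟩ := Finset.card_eq_one.1 (h.2 v)
    have key : ∀ f, (f ∈ M ∧ v ∈ f) ↔ f = e := by
      intro f
      rw [← Finset.mem_singleton, ← he, Finset.mem_inter]
      refine and_congr_right fun hf => ?_
      rw [mem_multiCut_singleton (hne f hf), hst]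
    exact ⟨e, (key e).2 rfl, fun f hf => (key f).1 hf⟩
  · obtain ⟨e, he, heu⟩ := h.2 v
    rw [Finset.card_eq_one]
    refine ⟨e, ?_⟩
    ext f
    have : f ∈ M ∩ multiCut s t {v} ↔ f ∈ M ∧ v ∈ f := by
      rw [Finset.mem_inter]
      refine and_congr_right fun hf => ?_
      rw [mem_multiCut_singleton (hne f hf), hst]
    rw [this, Finset.mem_singleton]
    exact ⟨fun hf => heu f hf, fun hf => hf ▸ he⟩

lemma IsCubic.card_inter_multiCut {V : Type*} [Fintype V] {G : SimpleGraph V} (h : IsCubic G)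
    {s t : Sym2 V → V} (hst : ∀ e, s(s e, t e) = e) (v : V) :
    (G.edgeFinset ∩ multiCut s t {v}).card = 3 := by
  have h1 : G.edgeFinset ∩ multiCut s t {v} = G.incidenceFinset v := by
    ext e
    rw [Finset.mem_inter, SimpleGraph.mem_edgeFinset, SimpleGraph.mem_incidenceFinset,
      SimpleGraph.incidenceSet, Set.mem_ofPred_eq]
    refine and_congr_right fun he => ?_
    rw [mem_multiCut_singleton (ends_ne_of_mem_edgeSet hst he), hst]
  rw [h1, SimpleGraph.card_incidenceFinset_eq_degree, ← SimpleGraph.card_neighborSet_eq_degree,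
    ← Nat.card_eq_fintype_card, Nat.card_coe_set_eq, h v]

/-- The weights `1` on the matching and `2` on the other edges lie in the perfect matching cone. -/
lemma inPMCone_of_isPerfectMatchingSet {V : Type*} [Fintype V] {G : SimpleGraph V}
    (hcubic : IsCubic G) (hbridgeless : Bridgeless G) {N : Finset (Sym2 V)}
    (hN : IsPerfectMatchingSet G (N : Set (Sym2 V)))
    (hwell : ∀ A : Set V, A.Nonempty → A ≠ Set.univ → (edgeCut G A).ncard = 3 →
        ((N : Set (Sym2 V)) ∩ edgeCut G A).ncard = 1)
    {s t : Sym2 V → V} (hst : ∀ e, s(s e, t e) = e) :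
    InPMCone s t (fun e => if e ∈ N then 1 else if e ∈ G.edgeFinset then 2 else 0) 5 := by
  have hsub : ∀ e ∈ N, e ∈ G.edgeFinset := fun e he => SimpleGraph.mem_edgeFinset.2 (hN.1 he)
  have hNpm : IsMultiPM s t N := (isMultiPM_iff_isPerfectMatchingSet hst hN.1).2 hN
  have hsum : ∀ A : Set V, ∑ e ∈ multiCut s t A,
      (if e ∈ N then (1 : ℝ) else if e ∈ G.edgeFinset then 2 else 0) =
        2 * (G.edgeFinset ∩ multiCut s t A).card - (N ∩ multiCut s t A).card := by
    intro A
    have : ∀ e ∈ multiCut s t A,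
        (if e ∈ N then (1 : ℝ) else if e ∈ G.edgeFinset then 2 else 0) =
          2 * (if e ∈ G.edgeFinset then 1 else 0) - if e ∈ N then 1 else 0 := by
      intro e _
      by_cases h1 : e ∈ N
      · simp only [h1, hsub e h1, if_true]; norm_num
      · simp [h1]
    rw [Finset.sum_congr rfl this, Finset.sum_sub_distrib, ← Finset.mul_sum, Finset.sum_boole,
      Finset.sum_boole, Finset.filter_mem_eq_inter, Finset.filter_mem_eq_inter,
      Finset.inter_comm, Finset.inter_comm (multiCut s t A) N]
  refine ⟨fun e => by split_ifs <;> norm_num, by norm_num, fun v => ?_,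
    fun A hA => ?_⟩
  · rw [hsum, hcubic.card_inter_multiCut hst, hNpm.2]; norm_num
  · rw [hsum]
    have hodd := odd_card_inter_multiCut (s := s) (t := t) (F := G.edgeFinset)
      (fun e he => ends_ne_of_mem_edgeSet hst (SimpleGraph.mem_edgeFinset.1 he))
      (fun v => by rw [hcubic.card_inter_multiCut hst v]; decide) hA
    have hcut : (edgeCut G A).ncard = (G.edgeFinset ∩ multiCut s t A).card := by
      rw [← coe_inter_multiCut hst, Set.ncard_coe_finset]
    have hne1 := edgeCut_ncard_ne_one hbridgeless A
    have hNcut : (N ∩ multiCut s t A : Finset _) = N ∩ (G.edgeFinset ∩ multiCut s t A) := by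
      ext e
      simp only [Finset.mem_inter]
      exact ⟨fun h => ⟨h.1, hsub e h.1, h.2⟩, fun h => ⟨h.1, h.2.2⟩⟩
    have hle : (N ∩ multiCut s t A).card ≤ (G.edgeFinset ∩ multiCut s t A).card := by
      rw [hNcut]; exact Finset.card_le_card Finset.inter_subset_right
    have h3 : (G.edgeFinset ∩ multiCut s t A).card = 3 → (N ∩ multiCut s t A).card = 1 := by
      intro h3
      rw [← hwell A (Set.nonempty_of_ncard_ne_zero hA.pos.ne') ?_ (hcut.trans h3),
        ← coe_inter_multiCut hst, ← Finset.coe_inter, Set.ncard_coe_finset, hNcut]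
      rintro rfl
      have : multiCut s t Set.univ = ∅ := by ext; simp [mem_multiCut]
      rw [this] at h3
      simp at h3
    have : 5 + (N ∩ multiCut s t A).card ≤ 2 * (G.edgeFinset ∩ multiCut s t A).card := by
      obtain ⟨k, hk⟩ := hodd
      rw [hcut] at hne1
      rcases Nat.lt_or_ge k 2 with hk2 | hk2
      · have := h3 (by omega)
        omega
      · omega
    have : (5 : ℝ) + (N ∩ multiCut s t A).card ≤ 2 * (G.edgeFinset ∩ multiCut s t A).card := by
      exact_mod_cast this
    linarith

end

theorem stmt_8 {V : Type*} [Fintype V] (G : SimpleGraph V)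
    (hcubic : IsCubic G) (hbridgeless : Bridgeless G)
    (M₁ : Set (Sym2 V)) (hM₁ : IsPerfectMatchingSet G M₁)
    (hwell : ∀ A : Set V, A.Nonempty → A ≠ Set.univ → (edgeCut G A).ncard = 3 →
        (M₁ ∩ edgeCut G A).ncard = 1) :
    ∃ M₂ : Set (Sym2 V), IsPerfectMatchingSet G M₂ ∧
      ((M₁ ∩ M₂).ncard : ℝ) ≤ (Fintype.card V : ℝ) / 10 := by
  classical
  rcases isEmpty_or_nonempty V with hV | hV
  · refine ⟨∅, ⟨Set.empty_subset _, fun v => (hV.false v).elim⟩, by simp⟩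
  obtain ⟨N, rfl⟩ := (Set.toFinite M₁).exists_finset_coe
  obtain ⟨s, t, hst⟩ : ∃ s t : Sym2 V → V, ∀ e, s(s e, t e) = e := by
    have : ∀ e : Sym2 V, ∃ a b, s(a, b) = e := fun e => by
      induction e with
      | h a b => exact ⟨a, b, rfl⟩
    choose s t hst using this
    exact ⟨s, t, hst⟩
  have hpm := (isMultiPM_iff_isPerfectMatchingSet hst hM₁.1).2 hM₁
  obtain ⟨M, hM, hMx, hle⟩ := (inPMCone_of_isPerfectMatchingSet hcubic hbridgeless hM₁ hwell
    hst).exists_isMultiPM_card_inter_le (by norm_num) hpm.1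
  have hMG : ∀ e ∈ M, e ∈ G.edgeSet := fun e he => by
    have := hMx e he
    by_cases h1 : e ∈ N
    · exact hM₁.1 h1
    · by_contra h2
      simp [h1, h2] at this
  refine ⟨M, (isMultiPM_iff_isPerfectMatchingSet hst hMG).1 hM, ?_⟩
  have hcard := sum_card_inter_multiCut_singleton_univ hpm.1
  simp only [hpm.2, Finset.sum_const, Finset.card_univ, smul_eq_mul, mul_one] at hcard
  have hsum : ∑ e ∈ N, (if e ∈ N then (1 : ℝ) else if e ∈ G.edgeFinset then 2 else 0) =
      N.card := by
    rw [Finset.sum_congr rfl fun e he => if_pos he]; simp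
  rw [← Finset.coe_inter, Set.ncard_coe_finset, hcard]
  push_cast
  have hle' : ((N ∩ M).card : ℝ) * 5 ≤ N.card := by
    rw [← hsum]
    convert hle
  linarith
end

section
/- Let G be a 3-edge-connected cubic graph, and let A be a vertex subset with ∅ ≠ A ⊊ V(G) and |δ(A)| = 3. Then for every vertex subset B with ∅ ≠ B ⊊ V(G) and |δ(B)| = 3, at least one of the following holds: B ⊆ A, B ⊆ V(G)∖A, A ⊆ B, or V(G)∖A ⊆ B. -/
open SimpleGraph Set

/-- The number of ordered adjacent pairs with first entry in `X` and second entry in `Y`. -/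
noncomputable def crossingCount {V : Type*} (G : SimpleGraph V) (X Y : Set V) : ℕ :=
  {p : V × V | p.1 ∈ X ∧ p.2 ∈ Y ∧ G.Adj p.1 p.2}.ncard

theorem crossingCount_comm {V : Type*} (G : SimpleGraph V) (X Y : Set V) :
    crossingCount G X Y = crossingCount G Y X := by
  unfold crossingCount
  rw [← Set.ncard_image_of_injective _ Prod.swap_injective]
  congr 1
  ext ⟨u, v⟩
  simp only [Set.mem_image, Set.mem_ofPred_eq, Prod.exists, Prod.swap_prod_mk, Prod.mk.injEq]
  constructor
  · rintro ⟨a, b, ⟨ha, hb, hab⟩, rfl, rfl⟩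
    exact ⟨hb, ha, hab.symm⟩
  · rintro ⟨hu, hv, huv⟩
    exact ⟨v, u, ⟨hv, hu, huv.symm⟩, rfl, rfl⟩

theorem crossingCount_union_right {V : Type*} [Finite V] (G : SimpleGraph V) (X : Set V)
    {Y Z : Set V} (h : Disjoint Y Z) :
    crossingCount G X (Y ∪ Z) = crossingCount G X Y + crossingCount G X Z := by
  unfold crossingCount
  rw [← Set.ncard_union_eq _ (Set.toFinite _) (Set.toFinite _)]
  · congr 1
    ext p
    simp only [Set.mem_union, Set.mem_ofPred_eq]
    tauto
  · rw [Set.disjoint_left]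
    rintro p ⟨-, hY, -⟩ ⟨-, hZ, -⟩
    exact Set.disjoint_left.mp h hY hZ

theorem crossingCount_union_left {V : Type*} [Finite V] (G : SimpleGraph V) {X Y : Set V}
    (Z : Set V) (h : Disjoint X Y) :
    crossingCount G (X ∪ Y) Z = crossingCount G X Z + crossingCount G Y Z := by
  rw [crossingCount_comm, crossingCount_union_right G Z h, crossingCount_comm G Z X,
    crossingCount_comm G Z Y]

theorem ncard_edgeCut_s10 {V : Type*} (G : SimpleGraph V) (X : Set V) :
    (edgeCut G X).ncard = crossingCount G X Xᶜ := by
  unfold crossingCount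
  rw [← Set.InjOn.ncard_image (f := fun p : V × V => s(p.1, p.2))]
  · congr 1
    ext e
    simp only [edgeCut, Set.mem_image, Set.mem_ofPred_eq, Prod.exists, Set.mem_compl_iff]
    constructor
    · rintro ⟨he, u, v, rfl, hu, hv⟩
      exact ⟨u, v, ⟨hu, hv, he⟩, rfl⟩
    · rintro ⟨u, v, ⟨hu, hv, huv⟩, rfl⟩
      exact ⟨huv, u, v, rfl, hu, hv⟩
  · rintro ⟨a, b⟩ ⟨ha, hb, -⟩ ⟨c, d⟩ ⟨hc, hd, -⟩ h
    rcases Sym2.eq_iff.mp h with ⟨h₁, h₂⟩ | ⟨h₁, h₂⟩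
    · exact Prod.ext h₁ h₂
    · simp only at h₁ h₂ ha hd
      exact absurd (h₁ ▸ ha) hd

/-- Nontrivial cuts of a 3-edge-connected graph have at least three edges. -/
theorem ThreeEdgeConnected.three_le_crossingCount {V : Type*} {G : SimpleGraph V}
    (h : ThreeEdgeConnected G) {X : Set V} (hX : X.Nonempty) (hX' : Xᶜ.Nonempty) :
    3 ≤ crossingCount G X Xᶜ := by
  rw [← ncard_edgeCut_s10]
  by_contra! hlt
  obtain ⟨a, ha⟩ := hX
  obtain ⟨b, hb⟩ := hX'
  obtain ⟨p⟩ := (h.2 _ hlt).preconnected a b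
  obtain ⟨d, -, hd₁, hd₂⟩ := p.exists_boundary_dart X ha hb
  have hd := d.adj
  rw [SimpleGraph.deleteEdges_adj] at hd
  exact hd.2 ⟨hd.1, _, _, rfl, hd₁, hd₂⟩

theorem stmt_10 {V : Type*} [Fintype V] (G : SimpleGraph V)
    (h3ec : ThreeEdgeConnected G) (hcubic : IsCubic G)
    (A : Set V) (hA : A.Nonempty) (hA' : A ≠ Set.univ)
    (hAcut : (edgeCut G A).ncard = 3) :
    ∀ B : Set V, B.Nonempty → B ≠ Set.univ → (edgeCut G B).ncard = 3 →
      B ⊆ A ∨ B ⊆ Set.univ \ A ∨ A ⊆ B ∨ Set.univ \ A ⊆ B := by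
  intro B _ _ hBcut
  by_contra! hcross
  obtain ⟨h₁, h₂, h₃, h₄⟩ := hcross
  have n₁ : (A ∩ B).Nonempty := by
    obtain ⟨x, hx, hx'⟩ := Set.not_subset.mp h₂
    exact ⟨x, by simpa using hx', hx⟩
  have n₂ : (A \ B).Nonempty := Set.sdiff_nonempty.mpr h₃
  have n₃ : (B \ A).Nonempty := Set.sdiff_nonempty.mpr h₁
  have n₄ : (A ∪ B)ᶜ.Nonempty := by
    obtain ⟨x, hx, hx'⟩ := Set.not_subset.mp h₄
    exact ⟨x, fun h => h.elim hx.2 hx'⟩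
  rw [ncard_edgeCut_s10] at hAcut hBcut
  generalize hP : A ∩ B = P at *
  generalize hQ : A \ B = Q at *
  generalize hR : B \ A = R at *
  generalize hS : (A ∪ B)ᶜ = S at *
  have eA : A = P ∪ Q := by grind
  have eB : B = P ∪ R := by grind
  have cA : Aᶜ = R ∪ S := by grind
  have cB : Bᶜ = Q ∪ S := by grind
  have cP : Pᶜ = Q ∪ (R ∪ S) := by grind
  have cQ : Qᶜ = P ∪ (R ∪ S) := by grind
  have cR : Rᶜ = P ∪ (Q ∪ S) := by grind
  have cS : Sᶜ = P ∪ (Q ∪ R) := by grind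
  have dPQ : Disjoint P Q := by rw [Set.disjoint_left]; grind
  have dPR : Disjoint P R := by rw [Set.disjoint_left]; grind
  have dPS : Disjoint P S := by rw [Set.disjoint_left]; grind
  have dQR : Disjoint Q R := by rw [Set.disjoint_left]; grind
  have dQS : Disjoint Q S := by rw [Set.disjoint_left]; grind
  have dRS : Disjoint R S := by rw [Set.disjoint_left]; grind
  have kP := h3ec.three_le_crossingCount n₁ (by rw [cP]; exact n₂.inl)
  have kQ := h3ec.three_le_crossingCount n₂ (by rw [cQ]; exact n₁.inl)
  have kR := h3ec.three_le_crossingCount n₃ (by rw [cR]; exact n₁.inl)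
  have kS := h3ec.three_le_crossingCount n₄ (by rw [cS]; exact n₁.inl)
  rw [cA, eA, crossingCount_union_left _ _ dPQ, crossingCount_union_right _ _ dRS,
    crossingCount_union_right _ _ dRS] at hAcut
  rw [cB, eB, crossingCount_union_left _ _ dPR, crossingCount_union_right _ _ dQS,
    crossingCount_union_right _ _ dQS] at hBcut
  rw [cP, crossingCount_union_right _ _ (dQR.union_right dQS),
    crossingCount_union_right _ _ dRS] at kP
  rw [cQ, crossingCount_union_right _ _ (dPR.union_right dPS),
    crossingCount_union_right _ _ dRS] at kQ
  rw [cR, crossingCount_union_right _ _ (dPQ.union_right dPS),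
    crossingCount_union_right _ _ dQS] at kR
  rw [cS, crossingCount_union_right _ _ (dPQ.union_right dPR),
    crossingCount_union_right _ _ dQR] at kS
  have := crossingCount_comm G P Q
  have := crossingCount_comm G P R
  have := crossingCount_comm G P S
  have := crossingCount_comm G Q R
  have := crossingCount_comm G Q S
  have := crossingCount_comm G R S
  omega
end
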